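/- arXiv:0911.0343 — 5 statements merged into one kernel-verified Lean document; each statement's English description precedes it below -/
import Mathlib

section
/- Let R be a (not necessarily commutative) ℤ-graded ring, T and F graded right R-modules, and E a graded injective envelope of F. Then Hom_{Gr}(T,E) = 0 (every degree-0 R-linear map T → E is zero) if and only if for every homogeneous t ∈ T and every nonzero homogeneous f ∈ F with deg(f) = deg(t), there exists a homogeneous r ∈ R such that t·r = 0 and f·r ≠ 0. -/
/-!
STATEMENT 1: For a ℤ-graded ring `R`, graded right `R`-modules `T`, `F` and a graded
injective envelope `E` of `F` (encoded by realizing `F` as a graded essential submodule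
of the graded-injective module `E`), one has `Hom_Gr(T, E) = 0` iff for every homogeneous
`t ∈ T` and nonzero homogeneous `f ∈ F` of the same degree there is a homogeneous `r ∈ R`
with `t·r = 0` and `f·r ≠ 0`.  Right modules are encoded as modules over `Rᵐᵒᵖ`.
-/

universe u

open DirectSum MulOpposite

/-- Compatibility of a grading on a right `R`-module with the grading of `R`:
`M_i · R_j ⊆ M_{i+j}`. -/
def RGradedSMul {R : Type u} [Ring R] (𝒜 : ℤ → AddSubgroup R)
    {M : Type u} [AddCommGroup M] [Module Rᵐᵒᵖ M] (ℳ : ℤ → AddSubgroup M) : Prop :=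
  ∀ ⦃i j : ℤ⦄ ⦃m : M⦄ ⦃r : R⦄, m ∈ ℳ i → r ∈ 𝒜 j → op r • m ∈ ℳ (i + j)

/-- A submodule is graded if it contains all homogeneous components of its elements. -/
def IsGradedSubmodule {R : Type u} [Ring R]
    {M : Type u} [AddCommGroup M] [Module Rᵐᵒᵖ M] (ℳ : ℤ → AddSubgroup M)
    [DirectSum.Decomposition ℳ] (N : Submodule Rᵐᵒᵖ M) : Prop :=
  ∀ x ∈ N, ∀ i : ℤ, (DirectSum.decompose ℳ x i : M) ∈ N

/-- `E` is graded-injective: every degree-0 map from a graded submodule of a graded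
right `R`-module extends to a degree-0 map on the whole module. -/
def GradedInjective {R : Type u} [Ring R] (𝒜 : ℤ → AddSubgroup R)
    {E : Type u} [AddCommGroup E] [Module Rᵐᵒᵖ E] (ℰ : ℤ → AddSubgroup E) : Prop :=
  ∀ (A : Type u) [AddCommGroup A] [Module Rᵐᵒᵖ A] (ℬ : ℤ → AddSubgroup A)
    [DirectSum.Decomposition ℬ],
    RGradedSMul 𝒜 ℬ →
    ∀ (A' : Submodule Rᵐᵒᵖ A), IsGradedSubmodule ℬ A' →
    ∀ f : A' →ₗ[Rᵐᵒᵖ] E,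
      (∀ (i : ℤ) (x : A'), (x : A) ∈ ℬ i → f x ∈ ℰ i) →
      ∃ g : A →ₗ[Rᵐᵒᵖ] E, (∀ i : ℤ, ∀ a ∈ ℬ i, g a ∈ ℰ i) ∧ ∀ x : A', g x = f x

/-- A graded submodule `F ⊆ E` is graded-essential if it meets every nonzero graded
submodule of `E` nontrivially. -/
def GradedEssential {R : Type u} [Ring R]
    {E : Type u} [AddCommGroup E] [Module Rᵐᵒᵖ E] (ℰ : ℤ → AddSubgroup E)
    [DirectSum.Decomposition ℰ] (F : Submodule Rᵐᵒᵖ E) : Prop :=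
  ∀ N : Submodule Rᵐᵒᵖ E, IsGradedSubmodule ℰ N → N ≠ ⊥ → N ⊓ F ≠ ⊥

theorem decompose_op_smul_aux {R : Type u} [Ring R] (𝒜 : ℤ → AddSubgroup R) [GradedRing 𝒜]
    {M : Type u} [AddCommGroup M] [Module Rᵐᵒᵖ M] (ℳ : ℤ → AddSubgroup M)
    [DirectSum.Decomposition ℳ] (hM : RGradedSMul 𝒜 ℳ) {i : ℤ} {m : M} (hm : m ∈ ℳ i)
    (r : R) (k : ℤ) :
    (DirectSum.decompose ℳ (op r • m) k : M) = op (DirectSum.decompose 𝒜 r (k - i) : R) • m := by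
  induction r using DirectSum.Decomposition.inductionOn 𝒜 with
  | zero => simp
  | @homogeneous j r =>
    have h := hM hm r.2
    by_cases hk : i + j = k
    · subst hk
      rw [DirectSum.decompose_of_mem_same _ h, add_sub_cancel_left,
        DirectSum.decompose_of_mem_same _ r.2]
    · rw [DirectSum.decompose_of_mem_ne _ h hk, DirectSum.decompose_of_mem_ne _ r.2 (by omega)]
      simp
  | add a b ha hb =>
    rw [op_add, add_smul, DirectSum.decompose_add, DirectSum.decompose_add, DirectSum.add_apply,
      DirectSum.add_apply, AddSubgroup.coe_add, AddSubgroup.coe_add, ha, hb, op_add, add_smul]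

theorem eq_zero_of_components_aux {M : Type u} [AddCommGroup M] (ℳ : ℤ → AddSubgroup M)
    [DirectSum.Decomposition ℳ] (x : M) (h : ∀ k, (DirectSum.decompose ℳ x k : M) = 0) :
    x = 0 := by
  apply (DirectSum.decompose ℳ).injective
  ext k
  simp [h k]

theorem stmt1 {R : Type u} [Ring R] (𝒜 : ℤ → AddSubgroup R) [GradedRing 𝒜]
    {T : Type u} [AddCommGroup T] [Module Rᵐᵒᵖ T] (𝒯 : ℤ → AddSubgroup T)
    [DirectSum.Decomposition 𝒯] (hT : RGradedSMul 𝒜 𝒯)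
    {E : Type u} [AddCommGroup E] [Module Rᵐᵒᵖ E] (ℰ : ℤ → AddSubgroup E)
    [DirectSum.Decomposition ℰ] (hE : RGradedSMul 𝒜 ℰ)
    (hEinj : GradedInjective 𝒜 ℰ)
    (F : Submodule Rᵐᵒᵖ E) (hF : IsGradedSubmodule ℰ F)
    (hFess : GradedEssential ℰ F) :
    (∀ f : T →ₗ[Rᵐᵒᵖ] E, (∀ i : ℤ, ∀ t ∈ 𝒯 i, f t ∈ ℰ i) → f = 0) ↔
    (∀ (i : ℤ) (t : T), t ∈ 𝒯 i → ∀ f : E, f ∈ F → f ∈ ℰ i → f ≠ 0 →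
      ∃ (j : ℤ) (r : R), r ∈ 𝒜 j ∧ op r • t = 0 ∧ op r • f ≠ 0) := by
  constructor
  · intro H i t ht f hfF hf hf0
    by_contra! hc
    have key : ∀ r : R, op r • t = 0 → op r • f = 0 := by
      intro r hr
      apply eq_zero_of_components_aux ℰ
      intro k
      rw [decompose_op_smul_aux 𝒜 ℰ hE hf]
      apply hc (k - i) _ (SetLike.coe_mem _)
      rw [← decompose_op_smul_aux 𝒜 𝒯 hT ht, hr]
      simp
    let φ := LinearMap.toSpanSingleton Rᵐᵒᵖ T t
    let ψ := LinearMap.toSpanSingleton Rᵐᵒᵖ E f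
    have hk : LinearMap.ker φ ≤ LinearMap.ker ψ := by
      intro x hx
      exact key x.unop hx
    let g : LinearMap.range φ →ₗ[Rᵐᵒᵖ] E :=
      ((LinearMap.ker φ).liftQ ψ hk).comp φ.quotKerEquivRange.symm.toLinearMap
    have hg : ∀ (x : Rᵐᵒᵖ) (hx : φ x ∈ LinearMap.range φ), g ⟨φ x, hx⟩ = x • f := by
      intro x hx
      change (LinearMap.ker φ).liftQ ψ hk (φ.quotKerEquivRange.symm ⟨φ x, hx⟩) = _
      rw [LinearMap.quotKerEquivRange_symm_apply_image]
      rfl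
    have hgr : IsGradedSubmodule 𝒯 (LinearMap.range φ) := by
      rintro _ ⟨x, rfl⟩ k
      refine ⟨op (DirectSum.decompose 𝒜 x.unop (k - i) : R), ?_⟩
      exact (decompose_op_smul_aux 𝒜 𝒯 hT ht x.unop k).symm
    obtain ⟨G, hG, hGg⟩ := hEinj T 𝒯 hT _ hgr g (by
      rintro k ⟨y, hy⟩ hx
      obtain ⟨x, rfl⟩ := LinearMap.mem_range.1 hy
      rw [hg]
      have h1 := decompose_op_smul_aux 𝒜 𝒯 hT ht x.unop k
      have h2 : op x.unop • t ∈ 𝒯 k := hx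
      rw [DirectSum.decompose_of_mem_same _ h2] at h1
      have h3 := key (x.unop - (DirectSum.decompose 𝒜 x.unop (k - i) : R)) (by
        rw [op_sub, sub_smul, ← h1, sub_self])
      rw [op_sub, sub_smul, sub_eq_zero, op_unop] at h3
      rw [h3]
      have h4 := hE hf (SetLike.coe_mem (DirectSum.decompose 𝒜 x.unop (k - i)))
      rwa [add_sub_cancel] at h4)
    have h1 := hGg ⟨φ 1, LinearMap.mem_range_self φ 1⟩
    rw [hg, H G hG, one_smul, LinearMap.zero_apply] at h1
    exact hf0 h1.symm
  · intro H g hg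
    have hom : ∀ (i : ℤ), ∀ t ∈ 𝒯 i, g t = 0 := by
      intro i t ht
      by_contra h0
      have hgt := hg i t ht
      have hne := hFess (Submodule.span Rᵐᵒᵖ {g t}) (by
        intro x hx k
        obtain ⟨r, rfl⟩ := Submodule.mem_span_singleton.1 hx
        have := decompose_op_smul_aux 𝒜 ℰ hE hgt r.unop k
        rw [op_unop] at this
        rw [this]
        exact Submodule.smul_mem _ _ (Submodule.mem_span_singleton_self _))
        (by simpa using h0)
      obtain ⟨x, ⟨hx, hxF⟩, hx0⟩ := Submodule.exists_mem_ne_zero_of_ne_bot hne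
      obtain ⟨r, rfl⟩ := Submodule.mem_span_singleton.1 hx
      apply hx0
      apply eq_zero_of_components_aux ℰ
      intro k
      by_contra hk0
      have hkF := hF _ hxF k
      have e := decompose_op_smul_aux 𝒜 ℰ hE hgt r.unop k
      rw [op_unop] at e
      have ht' := hT ht (SetLike.coe_mem (DirectSum.decompose 𝒜 r.unop (k - i)))
      rw [e, ← map_smul] at hkF hk0
      obtain ⟨j, s, -, hs, hs'⟩ := H _ _ ht' _ hkF (hg _ _ ht') hk0
      apply hs'
      rw [← map_smul, hs, map_zero]
    ext t
    induction t using DirectSum.Decomposition.inductionOn 𝒯 with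
    | zero => simp
    | homogeneous m => exact hom _ _ m.2
    | add a b ha hb => rw [map_add, ha, hb]; simp
end

section
/- Let R be a ℤ-graded ring, P a homogeneous two-sided prime ideal of R such that R/P is right Noetherian, E a graded injective envelope of the graded right R-module R/P, and C^g(P) the set of homogeneous c ∈ R such that c + P is neither a left nor a right zero divisor in R/P. Then for every homogeneous right ideal J of R the following are equivalent: (i) Hombar(R/J, E) = 0, i.e., for every d ∈ ℤ every degree-d R-linear map R/J → E is zero; (ii) for every homogeneous a ∈ R there exists c ∈ C^g(P) with a·c ∈ J. (That is, the graded Gabriel filter of the rigid torsion theory cogenerated by E coincides with the graded Gabriel filter associated to the multiplicative set C^g(P); hence a graded right R-module is torsion with respect to C^g(P) if and only if it is torsion for the rigid torsion theory associated to E.) -/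
/-!
STATEMENT 5: Let `R` be a ℤ-graded ring, `P` a homogeneous two-sided prime ideal with
`R/P` right Noetherian, and `E` a graded injective envelope of the graded right module
`R/P` (encoded by a degree-0 right-linear map `φ : R → E` with kernel `P` and graded
essential range, `E` graded-injective).  Then for every homogeneous right ideal `J`:
`Hombar(R/J, E) = 0` iff for every homogeneous `a ∈ R` there is `c ∈ C^g(P)` with
`a·c ∈ J`.  Right modules are encoded as modules over `Rᵐᵒᵖ`.
-/

universe u

open DirectSum MulOpposite

/-- `c` is a homogeneous element which is regular modulo `P`, i.e. `c ∈ C^g(P)`. -/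
def MemCg {R : Type u} [Ring R] (𝒜 : ℤ → AddSubgroup R) (P : Submodule Rᵐᵒᵖ R)
    (c : R) : Prop :=
  (∃ i : ℤ, c ∈ 𝒜 i) ∧ (∀ x : R, c * x ∈ P → x ∈ P) ∧ (∀ x : R, x * c ∈ P → x ∈ P)


section RG
variable {S : Type u} [Ring S]

def rgAnn (a : S) : Submodule Sᵐᵒᵖ S where
  carrier := {v | a * v = 0}
  add_mem' := by intro x y hx hy; simp only [Set.mem_ofPred_eq] at *; rw [mul_add, hx, hy, add_zero]
  zero_mem' := by simp
  smul_mem' := by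
    intro c x hx
    simp only [Set.mem_ofPred_eq, MulOpposite.smul_eq_mul_unop] at *
    rw [← mul_assoc, hx, zero_mul]

@[simp] lemma mem_rgAnn (a v : S) : v ∈ rgAnn a ↔ a * v = 0 := Iff.rfl

lemma rg_max [IsNoetherian Sᵐᵒᵖ S] (Q : Submodule Sᵐᵒᵖ S → Prop) (h : ∃ A, Q A) :
    ∃ A, Q A ∧ ∀ B, Q B → A ≤ B → B = A := by
  obtain ⟨A, hA, hm⟩ := (set_has_maximal_iff_noetherian (R := Sᵐᵒᵖ) (M := S)).2 inferInstance
    {A | Q A} h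
  refine ⟨A, hA, fun B hB hAB => ?_⟩
  by_contra hne
  exact hm B hB (lt_of_le_of_ne hAB (Ne.symm hne))

lemma rg_stab [IsNoetherian Sᵐᵒᵖ S] (f : ℕ → Submodule Sᵐᵒᵖ S) (hf : ∀ n, f n ≤ f (n + 1)) :
    ∃ n, ∀ m, n ≤ m → f m = f n := by
  obtain ⟨n, hn⟩ := (monotone_stabilizes_iff_noetherian (R := Sᵐᵒᵖ) (M := S)).2 inferInstance
    ⟨f, monotone_nat_of_le_succ hf⟩
  exact ⟨n, fun m hm => (hn m hm).symm⟩

lemma rg_pow_stab [IsNoetherian Sᵐᵒᵖ S] (x : S) :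
    ∃ N, 1 ≤ N ∧ ∀ v, x ^ N * (x ^ N * v) = 0 → x ^ N * v = 0 := by
  obtain ⟨n, hn⟩ := rg_stab (fun k => rgAnn (x ^ k)) (fun k v hv => by
    simp only [mem_rgAnn] at *
    rw [pow_succ', mul_assoc, hv, mul_zero])
  refine ⟨n + 1, by omega, fun v hv => ?_⟩
  have h1 : v ∈ rgAnn (x ^ (n + 1 + (n + 1))) := by
    simp only [mem_rgAnn]; rw [pow_add, mul_assoc, hv]
  have h2 := hn (n + 1 + (n + 1)) (by omega)
  have h3 := hn (n + 1) (by omega)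
  rw [h2, ← h3] at h1
  exact h1

lemma rg_pow {x : S} (hx : ∀ v, x * (x * v) = 0 → x * v = 0) (k : ℕ) (v : S)
    (h : x ^ (k + 1) * v = 0) : x * v = 0 := by
  induction k generalizing v with
  | zero => simpa using h
  | succ k ih =>
    apply hx
    apply ih
    rw [← mul_assoc, ← pow_succ, h]

lemma rg_pow_left {x : S} (hx : ∀ v, v * x * x = 0 → v * x = 0) (k : ℕ) (v : S)
    (h : v * x ^ (k + 1) = 0) : v * x = 0 := by
  induction k generalizing v with
  | zero => simpa using h
  | succ k ih =>
    apply hx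
    apply ih
    rw [mul_assoc, ← pow_succ', h]

def rgEss (D : Submodule Sᵐᵒᵖ S) : Prop := ∀ u : S, u ≠ 0 → ∃ s, u * s ≠ 0 ∧ u * s ∈ D

lemma rg_nonsing [IsNoetherian Sᵐᵒᵖ S]
    (hprime : ∀ a b : S, (∀ r, a * r * b = 0) → a = 0 ∨ b = 0)
    (t : S) (ht : rgEss (rgAnn t)) : t = 0 := by
  by_contra ht0
  obtain ⟨A, ⟨a, ha0, haE, rfl⟩, hmax⟩ := rg_max
    (fun A => ∃ b : S, b ≠ 0 ∧ rgEss (rgAnn b) ∧ A = rgAnn b) ⟨_, t, ht0, ht, rfl⟩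
  have key : ∀ s, a * s * a = 0 := by
    intro s
    by_contra hne
    have hb : rgEss (rgAnn (a * s)) := by
      intro u hu
      by_cases hsu : s * u = 0
      · exact ⟨1, by simpa using hu, by simp [mul_assoc, hsu]⟩
      · obtain ⟨s', h1, h2⟩ := haE _ hsu
        refine ⟨s', ?_, ?_⟩
        · intro h; apply h1; rw [mul_assoc, h, mul_zero]
        · simpa [mul_assoc] using h2
    obtain ⟨u, hu1, hu2⟩ := hb a ha0
    have hle : rgAnn a ≤ rgAnn (a * s * a) := by
      intro v hv
      simp only [mem_rgAnn] at *
      rw [mul_assoc, hv, mul_zero]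
    have hE' : rgEss (rgAnn (a * s * a)) := by
      intro u hu
      obtain ⟨s', h1, h2⟩ := haE u hu
      exact ⟨s', h1, hle h2⟩
    have heq := hmax _ ⟨_, hne, hE', rfl⟩ hle
    have : u ∈ rgAnn (a * s * a) := by
      simp only [mem_rgAnn] at *
      rw [mul_assoc, hu2]
    rw [heq] at this
    exact hu1 this
  rcases hprime a a key with h | h <;> exact ha0 h


def rgB (x u : S) : ℕ → Submodule Sᵐᵒᵖ S
  | 0 => ⊥
  | n + 1 => Submodule.span Sᵐᵒᵖ {u} ⊔ (rgB x u n).map (LinearMap.mulLeft Sᵐᵒᵖ x)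

lemma mem_rgB_succ (x u : S) (n : ℕ) (v : S) :
    v ∈ rgB x u (n + 1) ↔ ∃ s, ∃ b ∈ rgB x u n, v = u * s + x * b := by
  rw [rgB, Submodule.mem_sup]
  constructor
  · rintro ⟨y, hy, z, ⟨b, hb, rfl⟩, rfl⟩
    obtain ⟨r, rfl⟩ := Submodule.mem_span_singleton.1 hy
    exact ⟨r.unop, b, hb, rfl⟩
  · rintro ⟨s, b, hb, rfl⟩
    exact ⟨u * s, Submodule.mem_span_singleton.2 ⟨op s, rfl⟩, x * b, ⟨b, hb, rfl⟩, rfl⟩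

/-- if `x` is injective on `V`, `xV ⊆ V`, then `xV` is essential in `V` -/
lemma rg_ess [IsNoetherian Sᵐᵒᵖ S] (V : Submodule Sᵐᵒᵖ S) (x u : S)
    (hinj : ∀ v ∈ V, x * v = 0 → v = 0) (hxV : ∀ v ∈ V, x * v ∈ V) (hu : u ∈ V) (hu0 : u ≠ 0) :
    ∃ s, u * s ≠ 0 ∧ ∃ v ∈ V, u * s = x * v := by
  by_contra hcon
  push Not at hcon
  have hBV : ∀ n, rgB x u n ≤ V := by
    intro n
    induction n with
    | zero => exact bot_le
    | succ n ih =>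
      intro v hv
      obtain ⟨s, b, hb, rfl⟩ := (mem_rgB_succ _ _ _ _).1 hv
      exact V.add_mem (V.smul_mem (op s) hu) (hxV _ (ih hb))
  have hpV : ∀ n, x ^ n * u ∈ V := by
    intro n
    induction n with
    | zero => simpa using hu
    | succ n ih => rw [pow_succ', mul_assoc]; exact hxV _ ih
  have hnot : ∀ n, x ^ n * u ∉ rgB x u n := by
    intro n
    induction n with
    | zero => intro h; simp [rgB] at h; exact hu0 h
    | succ n ih =>
      intro h
      obtain ⟨s, b, hb, he⟩ := (mem_rgB_succ _ _ _ _).1 h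
      have h1 : u * s = x * (x ^ n * u - b) := by
        rw [mul_sub, ← mul_assoc, ← pow_succ', he]; abel
      have hm : x ^ n * u - b ∈ V := V.sub_mem (hpV n) (hBV n hb)
      have h2 : u * s = 0 := by
        by_contra h0
        exact hcon s h0 _ hm h1
      have h3 := hinj _ hm (by rw [← h1, h2])
      rw [sub_eq_zero.1 h3] at ih
      exact ih hb
  have hin : ∀ n, x ^ n * u ∈ rgB x u (n + 1) := by
    intro n
    induction n with
    | zero => exact (mem_rgB_succ _ _ _ _).2 ⟨1, 0, Submodule.zero_mem _, by simp⟩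
    | succ n ih =>
      exact (mem_rgB_succ _ _ _ _).2 ⟨0, _, ih, by rw [pow_succ']; simp [mul_assoc]⟩
  have hmono : ∀ n, rgB x u n ≤ rgB x u (n + 1) := by
    intro n
    induction n with
    | zero => exact bot_le
    | succ n ih =>
      intro v hv
      obtain ⟨s, b, hb, rfl⟩ := (mem_rgB_succ _ _ _ _).1 hv
      exact (mem_rgB_succ _ _ _ _).2 ⟨s, b, ih hb, rfl⟩
  obtain ⟨n, hn⟩ := rg_stab _ hmono
  have := hin n
  rw [hn (n + 1) (by omega)] at this
  exact hnot n this

lemma rg_left_regular [IsNoetherian Sᵐᵒᵖ S]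
    (hprime : ∀ a b : S, (∀ r, a * r * b = 0) → a = 0 ∨ b = 0)
    (c : S) (hc : ∀ v, c * v = 0 → v = 0) (t : S) (ht : t * c = 0) : t = 0 := by
  apply rg_nonsing hprime
  intro u hu
  obtain ⟨s, hs, v, -, hv⟩ := rg_ess ⊤ c u (fun v _ => hc v) (fun _ _ => trivial) trivial hu
  exact ⟨s, hs, by rw [hv, mem_rgAnn, ← mul_assoc, ht, zero_mul]⟩

lemma rg_left_ann [IsNoetherian Sᵐᵒᵖ S]
    (hprime : ∀ a b : S, (∀ r, a * r * b = 0) → a = 0 ∨ b = 0)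
    (x : S) (hx : ∀ v, x * (x * v) = 0 → x * v = 0) (t : S) (ht : t * x * x = 0) : t * x = 0 := by
  apply rg_nonsing hprime
  intro u hu
  by_cases hxu : x * u = 0
  · exact ⟨1, by simpa using hu, by simp [mul_assoc, hxu]⟩
  have hmem : ∀ w, w ∈ LinearMap.range (LinearMap.mulLeft Sᵐᵒᵖ x) ↔ ∃ v, x * v = w :=
    fun w => Iff.rfl
  obtain ⟨s, hs, v, hv, he⟩ := rg_ess (LinearMap.range (LinearMap.mulLeft Sᵐᵒᵖ x)) x (x * u)
    (by rintro _ ⟨v, rfl⟩ h; exact hx v h) (fun v _ => (hmem _).2 ⟨v, rfl⟩)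
    ((hmem _).2 ⟨u, rfl⟩) hxu
  obtain ⟨v, rfl⟩ := (hmem _).1 hv
  refine ⟨s, ?_, ?_⟩
  · intro h; apply hs; rw [mul_assoc, h, mul_zero]
  · rw [mem_rgAnn, mul_assoc, ← mul_assoc x, he, ← mul_assoc, ← mul_assoc, ht, zero_mul]

/-- abstract graded situation -/
structure RgGr (H : ℤ → S → Prop) : Prop where
  one : H 0 1
  zero : ∀ i, H i 0
  add : ∀ i a b, H i a → H i b → H i (a + b)
  mul : ∀ i j a b, H i a → H j b → H (i + j) (a * b)
  span : ∀ s, s ∈ AddSubgroup.closure {t | ∃ i, H i t}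

lemma RgGr.pow {H : ℤ → S → Prop} (h : RgGr H) {i : ℤ} {a : S} (ha : H i a) (n : ℕ) :
    H (n * i) (a ^ n) := by
  induction n with
  | zero => simpa using h.one
  | succ n ih =>
    have := h.mul _ _ _ _ ih ha
    rw [pow_succ]
    convert this using 1
    push_cast; ring

lemma RgGr.prime {H : ℤ → S → Prop} (h : RgGr H)
    (hprime : ∀ a b : S, (∀ r, a * r * b = 0) → a = 0 ∨ b = 0) (a b : S)
    (hab : ∀ i r, H i r → a * r * b = 0) : a = 0 ∨ b = 0 := by
  apply hprime
  intro r
  induction h.span r using AddSubgroup.closure_induction with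
  | mem x hx => obtain ⟨i, hi⟩ := hx; exact hab i x hi
  | zero => simp
  | add x y _ _ hx hy => rw [mul_add, add_mul, hx, hy, add_zero]
  | neg x _ hx => rw [mul_neg, neg_mul, hx, neg_zero]

def RgGood (H : ℤ → S → Prop) (n : ℤ) : Prop :=
  ∀ d : ℤ, ∃ M : ℕ, ∀ m : ℕ, M ≤ m → ∀ w, H (m * n + d) w → ¬ IsNilpotent w →
    ∃ k j : ℕ, 1 ≤ k ∧ 1 ≤ j ∧ (j : ℤ) * (m * n + d) = k * n

lemma rg_nil_pow (w : S) (j : ℕ) (h : IsNilpotent (w ^ j)) : IsNilpotent w := by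
  obtain ⟨q, hq⟩ := h
  exact ⟨j * q, by rw [pow_mul, hq]⟩

lemma rg_cyc (a b : S) (h : IsNilpotent (b * a)) : IsNilpotent (a * b) := by
  obtain ⟨n, hn⟩ := h
  refine ⟨n + 1, ?_⟩
  have : ∀ k : ℕ, (a * b) ^ (k + 1) = a * (b * a) ^ k * b := by
    intro k
    induction k with
    | zero => simp
    | succ k ih => rw [pow_succ, ih, pow_succ]; simp only [mul_assoc]
  rw [this, hn]; simp

lemma rg_key [IsNoetherian Sᵐᵒᵖ S] {H : ℤ → S → Prop} (hH : RgGr H)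
    (hprime : ∀ a b : S, (∀ r, a * r * b = 0) → a = 0 ∨ b = 0)
    (n : ℤ) (hn : RgGood H n)
    (x : S) (hxn : H n x) (hx0 : x ≠ 0) (hx : ∀ v, x * (x * v) = 0 → x * v = 0)
    (y : S) (e : ℤ) (hy : H e y) (hy0 : y ≠ 0) :
    ∃ s : S, ∃ k : ℕ, 1 ≤ k ∧ H (k * n) (y * s) ∧ ¬ IsNilpotent (y * s) := by
  by_contra hcon
  push Not at hcon
  have hxl := rg_left_ann hprime x hx
  have hxl' := rg_pow_left hxl
  obtain ⟨it, t, ht, hyt⟩ : ∃ i t, H i t ∧ y * t * x ≠ 0 := by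
    by_contra h
    push Not at h
    rcases hH.prime hprime y x h with h | h
    · exact hy0 h
    · exact hx0 h
  have hy1 : H (e + it + n) (y * t * x) := hH.mul _ _ _ _ (hH.mul _ _ _ _ hy ht) hxn
  obtain ⟨_, ⟨i0, s0, hs0, hz0, rfl⟩, hmax⟩ := rg_max
    (fun A => ∃ i s, H i s ∧ s * (y * t * x) ≠ 0 ∧ A = rgAnn (s * (y * t * x)))
    ⟨_, 0, 1, hH.one, by simpa using hyt, rfl⟩
  set z := s0 * (y * t * x) with hz
  have hzd := hH.mul _ _ _ _ hs0 hy1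
  have step : ∀ i s, H i s → ∃ M : ℕ, ∀ m, M ≤ m → z * x ^ m * (s * z) = 0 := by
    intro i s hs
    obtain ⟨M, hM⟩ := hn (i + (i0 + (e + it + n)))
    refine ⟨M, fun m hm => ?_⟩
    have hwd : H (m * n + (i + (i0 + (e + it + n)))) (x ^ m * (s * z)) :=
      hH.mul _ _ _ _ (hH.pow hxn m) (hH.mul _ _ _ _ hs hzd)
    have hnil : IsNilpotent (x ^ m * (s * z)) := by
      by_contra hnn
      obtain ⟨k, j, hk, hj, hkj⟩ := hM m hm _ hwd hnn
      have hw' : H (m * n + (i + (i0 + (e + it + n)))) (y * (t * x * x ^ m * s * s0)) := by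
        have := hH.mul _ _ _ _ hy (hH.mul _ _ _ _ (hH.mul _ _ _ _ (hH.mul _ _ _ _
          (hH.mul _ _ _ _ ht hxn) (hH.pow hxn m)) hs) hs0)
        convert this using 1
        ring
      have hp := hH.pow hw' j
      rw [hkj] at hp
      obtain ⟨j, rfl⟩ : ∃ j', j = j' + 1 := ⟨j - 1, by omega⟩
      rw [pow_succ', mul_assoc] at hp
      have hnil2 := hcon _ k hk hp
      rw [← mul_assoc, ← pow_succ'] at hnil2
      have hnil3 : IsNilpotent (y * (t * x * x ^ m * s * s0)) :=
        rg_nil_pow _ _ hnil2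
      apply hnn
      have : x ^ m * (s * z) = (x ^ m * s * s0) * (y * t * x) := by
        rw [hz]; simp only [mul_assoc]
      rw [this]
      apply rg_cyc
      simpa only [mul_assoc] using hnil3
    rw [mul_assoc]
    by_cases hw0 : x ^ m * (s * z) = 0
    · rw [hw0, mul_zero]
    set w := x ^ m * (s * z) with hw
    have hex : ∃ q, w ^ q = 0 := hnil
    classical
    have hq := Nat.find_spec hex
    have hqm : ∀ p, p < Nat.find hex → w ^ p ≠ 0 := fun p hp => Nat.find_min hex hp
    obtain ⟨q, hqq⟩ : ∃ q, Nat.find hex = q + 2 := by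
      refine ⟨Nat.find hex - 2, ?_⟩
      have h0 : Nat.find hex ≠ 0 := by
        intro h
        rw [h, pow_zero] at hq
        apply hw0
        rw [← mul_one w, hq, mul_zero]
      have h1 : Nat.find hex ≠ 1 := by
        intro h
        rw [h, pow_one] at hq
        exact hw0 hq
      omega
    rw [hqq] at hq hqm
    have hne := hqm (q + 1) (by omega)
    have hform : w ^ (q + 1) = (w ^ q * (x ^ m * (s * s0))) * (y * t * x) := by
      rw [pow_succ]
      conv_lhs => rw [hw, hz]
      simp only [mul_assoc, hw, hz]
    have hle : rgAnn z ≤ rgAnn (w ^ (q + 1)) := by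
      intro v hv
      rw [mem_rgAnn] at *
      rw [pow_succ, hw, mul_assoc, mul_assoc, mul_assoc, hv]; simp
    have heq := hmax (rgAnn (w ^ (q + 1))) ⟨_, _, hH.mul _ _ _ _ (hH.pow hwd q)
      (hH.mul _ _ _ _ (hH.pow hxn m) (hH.mul _ _ _ _ hs hs0)), by rw [← hform]; exact hne,
      by rw [← hform]⟩ hle
    have : w ∈ rgAnn (w ^ (q + 1)) := by rw [mem_rgAnn, ← pow_succ]; exact hq
    rw [heq] at this
    exact this
  obtain ⟨N, hN⟩ := rg_stab (fun N => ⨅ m : ℕ, ⨅ _ : N ≤ m, rgAnn (z * x ^ m)) (by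
    intro N v hv
    simp only [Submodule.mem_iInf] at *
    exact fun m hm => hv m (by omega))
  have hfin : ∀ i s, H i s → (z * x ^ N) * s * z = 0 := by
    intro i s hs
    obtain ⟨M, hM⟩ := step i s hs
    have h1 : s * z ∈ ⨅ m : ℕ, ⨅ _ : max M N ≤ m, rgAnn (z * x ^ m) := by
      simp only [Submodule.mem_iInf]
      exact fun m hm => hM m (le_trans (le_max_left _ _) hm)
    rw [hN (max M N) (le_max_right _ _)] at h1
    simp only [Submodule.mem_iInf] at h1
    have := h1 N le_rfl
    rw [mem_rgAnn] at this
    rw [mul_assoc _ s z, this]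
  rcases hH.prime hprime _ _ hfin with h | h
  · apply hz0
    rw [hz]
    have h2 : (s0 * (y * t)) * x ^ (N + 1) = 0 := by
      rw [← h, hz, pow_succ']; simp only [mul_assoc]
    have := hxl' N _ h2
    rw [← this]; simp only [mul_assoc]
  · exact hz0 h

lemma rg_exists_n [IsNoetherian Sᵐᵒᵖ S] [Nontrivial S] {H : ℤ → S → Prop} (hH : RgGr H)
    (hprime : ∀ a b : S, (∀ r, a * r * b = 0) → a = 0 ∨ b = 0) :
    ∃ n : ℤ, ∀ y e, H e y → y ≠ 0 →
      ∃ s : S, ∃ k : ℕ, 1 ≤ k ∧ H (k * n) (y * s) ∧ ¬ IsNilpotent (y * s) := by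
  by_cases hall : ∀ d w, H d w → ¬ IsNilpotent w → d = 0
  · refine ⟨0, fun y e hy hy0 => rg_key hH hprime 0 ?_ 1 hH.one one_ne_zero (by simp) y e hy hy0⟩
    intro d
    refine ⟨0, fun m _ w hw hwn => ⟨1, 1, le_rfl, le_rfl, ?_⟩⟩
    have := hall _ _ hw hwn
    rw [this]
  · push Not at hall
    obtain ⟨d, w, hw, hwn, hd⟩ := hall
    obtain ⟨N, hN, hst⟩ := rg_pow_stab w
    refine ⟨N * d, fun y e hy hy0 => rg_key hH hprime (N * d) ?_ (w ^ N) (hH.pow hw N)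
      (fun h => hwn ⟨N, h⟩) hst y e hy hy0⟩
    have hnd : (N : ℤ) * d ≠ 0 := mul_ne_zero (by exact_mod_cast (by omega)) hd
    generalize (N : ℤ) * d = n at hnd
    intro e
    refine ⟨e.natAbs + 1, fun m hm w _ _ => ?_⟩
    have hm' : |e| + 1 ≤ (m : ℤ) := by rw [Int.abs_eq_natAbs]; exact_mod_cast hm
    have h1 := neg_abs_le e
    have h2 := le_abs_self e
    rcases lt_or_gt_of_ne hnd with h | h
    · refine ⟨(-(m * n + e)).toNat, (-n).toNat, ?_, ?_, ?_⟩
      · have : (m : ℤ) * n + e < 0 := by nlinarith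
        omega
      · omega
      · have : (m : ℤ) * n + e < 0 := by nlinarith
        rw [Int.toNat_of_nonneg (by omega), Int.toNat_of_nonneg (by omega)]; ring
    · refine ⟨(m * n + e).toNat, n.toNat, ?_, ?_, ?_⟩
      · have : 0 < (m : ℤ) * n + e := by nlinarith
        omega
      · omega
      · have : 0 < (m : ℤ) * n + e := by nlinarith
        rw [Int.toNat_of_nonneg (by omega), Int.toNat_of_nonneg (by omega)]; ring

/-- graded Goldie -/
lemma rg_goldie [IsNoetherian Sᵐᵒᵖ S] [Nontrivial S] {H : ℤ → S → Prop} (hH : RgGr H)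
    (hprime : ∀ a b : S, (∀ r, a * r * b = 0) → a = 0 ∨ b = 0)
    (I : Submodule Sᵐᵒᵖ S)
    (hI : ∀ c d, H d c → (∃ v, v ≠ 0 ∧ c * v = 0) → ∃ e v, H e v ∧ v ∈ I ∧ v ≠ 0 ∧ c * v = 0) :
    ∃ c d, H d c ∧ c ∈ I ∧ (∀ v, c * v = 0 → v = 0) ∧ (∀ v, v * c = 0 → v = 0) := by
  obtain ⟨n, hn⟩ := rg_exists_n hH hprime
  obtain ⟨A, ⟨c, k, hk, hcI, hcd, hcc, hA⟩, hmax⟩ := rg_max (fun A : Submodule Sᵐᵒᵖ S =>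
    ∃ c : S, ∃ k : ℕ, 1 ≤ k ∧ c ∈ I ∧ H (k * n) c ∧ (∀ v, c * (c * v) = 0 → c * v = 0) ∧
      ∀ v ∈ A, c * v = 0 → v = 0)
    ⟨⊥, 0, 1, le_rfl, I.zero_mem, hH.zero _, by simp, by simp⟩
  have hreg : ∀ v, c * v = 0 → v = 0 := by
    by_contra hcon
    push Not at hcon
    obtain ⟨v, hv, hv0⟩ := hcon
    obtain ⟨e, y, hy, hyI, hy0, hcy⟩ := hI c _ hcd ⟨v, hv0, hv⟩
    obtain ⟨s, l, hl, hsd, hsn⟩ := hn y e hy hy0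
    obtain ⟨N, hN, hst⟩ := rg_pow_stab (y * s)
    obtain ⟨N, rfl⟩ : ∃ N', N = N' + 1 := ⟨N - 1, by omega⟩
    set a := (y * s) ^ (N + 1) with ha
    have had : H (((N + 1) * l : ℕ) * n) a := by
      have := hH.pow hsd (N + 1)
      convert this using 1
      push_cast; ring
    have ha0 : ¬ IsNilpotent a := fun h => hsn (rg_nil_pow _ _ h)
    have haI : a ∈ I := by
      rw [ha, pow_succ', mul_assoc]
      exact I.smul_mem (op _) hyI
    have hca : c * a = 0 := by
      rw [ha, pow_succ', ← mul_assoc, ← mul_assoc, hcy]; simp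
    obtain ⟨l', hl', had'⟩ : ∃ l' : ℕ, l' + 1 = (N + 1) * l ∧ H (((l' + 1 : ℕ) : ℤ) * n) a := by
      have hpos : 1 ≤ (N + 1) * l := Nat.mul_pos (by omega) hl
      refine ⟨(N + 1) * l - 1, by omega, ?_⟩
      rwa [Nat.sub_add_cancel hpos]
    obtain ⟨k', rfl⟩ : ∃ k', k = k' + 1 := ⟨k - 1, by omega⟩
    -- powers
    have hC : ∀ v, c ^ (l' + 1) * v = 0 ↔ c * v = 0 := fun v =>
      ⟨rg_pow hcc l' v, fun h => by rw [pow_succ, mul_assoc, h, mul_zero]⟩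
    have hAa : ∀ v, a ^ (k' + 1) * v = 0 ↔ a * v = 0 := fun v =>
      ⟨rg_pow hst k' v, fun h => by rw [pow_succ, mul_assoc, h, mul_zero]⟩
    have hCd : H (((k' + 1) * (l' + 1) : ℕ) * n) (c ^ (l' + 1)) := by
      have := hH.pow hcd (l' + 1)
      convert this using 1
      push_cast; ring
    have hAd : H (((k' + 1) * (l' + 1) : ℕ) * n) (a ^ (k' + 1)) := by
      have := hH.pow had' (k' + 1)
      convert this using 1
      push_cast; ring
    have hCA : c * a ^ (k' + 1) = 0 := by rw [pow_succ', ← mul_assoc, hca, zero_mul]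
    have hsum : ∀ v, (c ^ (l' + 1) + a ^ (k' + 1)) * v = 0 → c * v = 0 ∧ a * v = 0 := by
      intro v hv
      rw [add_mul] at hv
      have h1 : c * (c ^ (l' + 1) * v) = 0 := by
        have : c * (c ^ (l' + 1) * v + a ^ (k' + 1) * v) = 0 := by rw [hv, mul_zero]
        rwa [mul_add, ← mul_assoc c (a ^ _), hCA, zero_mul, add_zero] at this
      have h2 : c * v = 0 := by
        apply rg_pow hcc (l' + 1)
        rw [pow_succ', mul_assoc, h1]
      refine ⟨h2, ?_⟩
      rwa [(hC v).2 h2, zero_add, hAa] at hv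
    have hmem : a ∈ A ⊔ Submodule.span Sᵐᵒᵖ {a} :=
      Submodule.mem_sup_right (Submodule.mem_span_singleton_self a)
    have heq := hmax (A ⊔ Submodule.span Sᵐᵒᵖ {a}) ⟨c ^ (l' + 1) + a ^ (k' + 1),
      (k' + 1) * (l' + 1), Nat.mul_pos (by omega) (by omega), ?_, hH.add _ _ _ hCd hAd, ?_, ?_⟩
      le_sup_left
    · rw [heq] at hmem
      have := hA a hmem hca
      exact ha0 (this ▸ IsNilpotent.zero)
    · refine I.add_mem ?_ ?_
      · rw [pow_succ']; exact I.smul_mem (op _) hcI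
      · rw [pow_succ']; exact I.smul_mem (op _) haI
    · intro v hv
      obtain ⟨h1, h2⟩ := hsum _ hv
      have h3 : c * v = 0 := by
        rw [add_mul, mul_add, ← mul_assoc c (a ^ _), hCA, zero_mul, add_zero] at h1
        apply rg_pow hcc (l' + 1)
        rw [pow_succ', mul_assoc, h1]
      have h4 : a * v = 0 := by
        rw [add_mul, (hC v).2 h3, zero_add] at h2
        apply rg_pow hst (k' + 1)
        rw [pow_succ', mul_assoc, h2]
      rw [add_mul, (hC v).2 h3, (hAa v).2 h4, add_zero]
    · intro v hv h
      obtain ⟨h1, h2⟩ := hsum _ h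
      obtain ⟨α, hα, β, hβ, rfl⟩ := Submodule.mem_sup.1 hv
      obtain ⟨r, rfl⟩ := Submodule.mem_span_singleton.1 hβ
      have h5 : α = 0 := by
        apply hA α hα
        rw [mul_add, MulOpposite.smul_eq_mul_unop, ← mul_assoc, hca, zero_mul, add_zero] at h1
        exact h1
      subst h5
      rw [zero_add, MulOpposite.smul_eq_mul_unop] at h2 ⊢
      exact hst _ h2
  exact ⟨c, _, hcd, hcI, hreg, rg_left_regular hprime c hreg⟩
end RG

section RG2

lemma rg_decomp {M N : Type u} [AddCommGroup M] [AddCommGroup N] (ℳ : ℤ → AddSubgroup M)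
    (𝒩 : ℤ → AddSubgroup N) [DirectSum.Decomposition ℳ] [DirectSum.Decomposition 𝒩]
    (ψ : M →+ N) (d : ℤ) (hψ : ∀ i, ∀ m ∈ ℳ i, ψ m ∈ 𝒩 (i + d)) (x : M) (i : ℤ) :
    (DirectSum.decompose 𝒩 (ψ x) (i + d) : N) = ψ (DirectSum.decompose ℳ x i : M) := by
  induction x using DirectSum.Decomposition.inductionOn ℳ with
  | zero => simp
  | @homogeneous j m =>
    by_cases h : j = i
    · subst h
      rw [DirectSum.decompose_of_mem_same _ (hψ _ _ m.2), DirectSum.decompose_of_mem_same _ m.2]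
    · rw [DirectSum.decompose_of_mem_ne _ (hψ _ _ m.2) (by omega),
        DirectSum.decompose_of_mem_ne _ m.2 h, map_zero]
  | add a b ha hb =>
    simp only [map_add, DirectSum.decompose_add, DirectSum.add_apply, AddSubgroup.coe_add, ha, hb]

abbrev rgShift {M : Type u} [AddCommGroup M] (ℳ : ℤ → AddSubgroup M) (α : ℤ) : ℤ → AddSubgroup M :=
  fun i => ℳ (i + α)

@[reducible] noncomputable def rgShiftDec {M : Type u} [AddCommGroup M] (ℳ : ℤ → AddSubgroup M)
    [DirectSum.Decomposition ℳ] (α : ℤ) : DirectSum.Decomposition (rgShift ℳ α) := by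
  refine DirectSum.Decomposition.ofAddHom (rgShift ℳ α)
    { toFun := fun x => (DFinsupp.comapDomain (fun i : ℤ => i + α) (add_left_injective α)
        (DirectSum.decompose ℳ x) : Π₀ i, rgShift ℳ α i)
      map_zero' := by
        rw [DirectSum.decompose_zero]
        exact DFinsupp.comapDomain_zero _ _
      map_add' := fun x y => by
        rw [DirectSum.decompose_add]
        exact DFinsupp.comapDomain_add _ _ _ _ } ?_ ?_
  · ext x
    simp only [AddMonoidHom.comp_apply, AddMonoidHom.id_apply]
    induction x using DirectSum.Decomposition.inductionOn ℳ with
    | zero => simp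
    | @homogeneous j m =>
      obtain ⟨i, rfl⟩ : ∃ i, j = i + α := ⟨j - α, by omega⟩
      have : (DFinsupp.comapDomain (fun i : ℤ => i + α) (add_left_injective α)
          (DirectSum.decompose ℳ (m : M)) : Π₀ i, rgShift ℳ α i) =
          DirectSum.of (fun i => rgShift ℳ α i) i m := by
        rw [DirectSum.decompose_coe]
        exact DFinsupp.comapDomain_single (β := fun i => ℳ i) (fun i : ℤ => i + α) (add_left_injective α) i m
      change DirectSum.coeAddMonoidHom (rgShift ℳ α) (DFinsupp.comapDomain (fun i : ℤ => i + α)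
        (add_left_injective α) (DirectSum.decompose ℳ (m : M)) : Π₀ i, rgShift ℳ α i) = _
      rw [this, DirectSum.coeAddMonoidHom_of]
    | add a b ha hb => rw [map_add, map_add, ha, hb]
  · ext1 i
    ext1 m
    simp only [AddMonoidHom.comp_apply, AddMonoidHom.id_apply, DirectSum.coeAddMonoidHom_of]
    have : (DFinsupp.comapDomain (fun i : ℤ => i + α) (add_left_injective α)
          (DirectSum.decompose ℳ (m : M)) : Π₀ i, rgShift ℳ α i) =
          DirectSum.of (fun i => rgShift ℳ α i) i m := by
      have h := DirectSum.decompose_coe ℳ (i := i + α) m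
      rw [h]
      exact DFinsupp.comapDomain_single (β := fun i => ℳ i) (fun i : ℤ => i + α) (add_left_injective α) i m
    exact this

lemma rgShiftDec_apply {M : Type u} [AddCommGroup M] (ℳ : ℤ → AddSubgroup M)
    [DirectSum.Decomposition ℳ] (α : ℤ) (x : M) (i : ℤ) :
    ((@DirectSum.decompose _ _ _ _ _ _ _ (rgShift ℳ α) (rgShiftDec ℳ α) x) i : M) =
      DirectSum.decompose ℳ x (i + α) := by
  let _ := rgShiftDec ℳ α
  have := rg_decomp ℳ (rgShift ℳ α) (AddMonoidHom.id M) (-α) (by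
    intro i m hm
    simpa [rgShift] using hm) x (i + α)
  rw [show i + α + -α = i by ring] at this
  simpa using this

lemma rg_ii_i {R : Type u} [Ring R] (𝒜 : ℤ → AddSubgroup R) [GradedRing 𝒜]
    (P : Submodule Rᵐᵒᵖ R)
    {E : Type u} [AddCommGroup E] [Module Rᵐᵒᵖ E] (ℰ : ℤ → AddSubgroup E)
    [DirectSum.Decomposition ℰ] (hE : RGradedSMul 𝒜 ℰ)
    (φ : R →ₗ[Rᵐᵒᵖ] E) (hφdeg : ∀ i : ℤ, ∀ r ∈ 𝒜 i, φ r ∈ ℰ i)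
    (hφker : LinearMap.ker φ = P)
    (hφess : GradedEssential ℰ (LinearMap.range φ))
    (J : Submodule Rᵐᵒᵖ R)
    (h : ∀ a : R, (∃ i : ℤ, a ∈ 𝒜 i) → ∃ c : R, MemCg 𝒜 P c ∧ a * c ∈ J)
    (d : ℤ) (f : (R ⧸ J) →ₗ[Rᵐᵒᵖ] E)
    (hf : ∀ (i : ℤ) (x : R ⧸ J),
          x ∈ AddSubgroup.map J.mkQ.toAddMonoidHom (𝒜 i) → f x ∈ ℰ (i + d)) : f = 0 := by
  have key : ∀ i, ∀ a ∈ 𝒜 i, f (J.mkQ a) = 0 := by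
    intro i a ha
    by_contra he
    have heE : f (J.mkQ a) ∈ ℰ (i + d) := hf i _ ⟨a, ha, rfl⟩
    set e := f (J.mkQ a) with hedef
    let ψ : R →+ E :=
      { toFun := fun r => op r • e
        map_zero' := by simp
        map_add' := fun x y => by simp [add_smul] }
    have hψ : ∀ k, ∀ r ∈ 𝒜 k, ψ r ∈ ℰ (k + (i + d)) := by
      intro k r hr
      have := hE heE hr
      rw [add_comm]
      exact this
    have hdec := rg_decomp 𝒜 ℰ ψ (i + d) hψ
    have hdec' : ∀ r k, (DirectSum.decompose ℰ (op r • e) k : E) =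
        op (DirectSum.decompose 𝒜 r (k - (i + d)) : R) • e := by
      intro r k
      have := hdec r (k - (i + d))
      rw [sub_add_cancel] at this
      exact this
    have hφdec := rg_decomp 𝒜 ℰ φ.toAddMonoidHom 0 (by simpa using hφdeg)
    have hNgr : IsGradedSubmodule ℰ (Submodule.span Rᵐᵒᵖ {e}) := by
      intro x hx k
      obtain ⟨r, rfl⟩ := Submodule.mem_span_singleton.1 hx
      have := hdec' r.unop k
      rw [op_unop] at this
      rw [this]
      exact Submodule.mem_span_singleton.2 ⟨_, rfl⟩
    have hN0 : Submodule.span Rᵐᵒᵖ {e} ≠ ⊥ := by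
      rw [Ne, Submodule.span_singleton_eq_bot]; exact he
    obtain ⟨x, hx, hx0⟩ := Submodule.exists_mem_ne_zero_of_ne_bot (hφess _ hNgr hN0)
    obtain ⟨hx1, s, hs⟩ := Submodule.mem_inf.1 hx
    obtain ⟨r, hr⟩ := Submodule.mem_span_singleton.1 hx1
    obtain ⟨k, hk⟩ : ∃ k, (DirectSum.decompose ℰ x k : E) ≠ 0 := by
      by_contra hcon
      push Not at hcon
      apply hx0
      apply (DirectSum.decompose ℰ).injective
      rw [DirectSum.decompose_zero]
      ext k
      simpa using hcon k
    have h1 := hdec' r.unop k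
    rw [op_unop, hr] at h1
    have h2 := hφdec s k
    rw [add_zero] at h2
    change (DirectSum.decompose ℰ (φ s) k : E) = φ _ at h2
    rw [hs] at h2
    set r' : R := (DirectSum.decompose 𝒜 r.unop (k - (i + d)) : R) with hr'
    have hr'd : r' ∈ 𝒜 (k - (i + d)) := SetLike.coe_mem _
    set s' : R := (DirectSum.decompose 𝒜 s k : R)
    obtain ⟨c, ⟨_, _, hc⟩, hcJ⟩ := h (a * r') ⟨_, SetLike.mul_mem_graded ha hr'd⟩
    have h3 : φ (s' * c) = 0 := by
      have e1 : φ (s' * c) = op c • φ s' := φ.map_smul (op c) s'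
      rw [e1, ← h2, h1, hedef, ← map_smul, ← map_smul, ← map_smul, ← map_smul]
      have : op c • op r' • a = a * r' * c := rfl
      rw [this, Submodule.mkQ_apply, (Submodule.Quotient.mk_eq_zero J).2 hcJ, map_zero]
    have h4 : s' * c ∈ P := by rw [← hφker]; exact h3
    have h5 := hc _ h4
    rw [← hφker] at h5
    exact hk (h2.trans h5)
  refine LinearMap.ext fun x => ?_
  obtain ⟨x, rfl⟩ := J.mkQ_surjective x
  rw [LinearMap.zero_apply]
  induction x using DirectSum.Decomposition.inductionOn 𝒜 with
  | zero => simp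
  | @homogeneous j m => exact key j m m.2
  | add a b ha hb => rw [map_add, map_add, ha, hb, add_zero]

lemma rg_i_ess {R : Type u} [Ring R] (𝒜 : ℤ → AddSubgroup R) [GradedRing 𝒜]
    (P : Submodule Rᵐᵒᵖ R)
    {E : Type u} [AddCommGroup E] [Module Rᵐᵒᵖ E] (ℰ : ℤ → AddSubgroup E)
    (hEinj : GradedInjective 𝒜 ℰ)
    (φ : R →ₗ[Rᵐᵒᵖ] E) (hφdeg : ∀ i : ℤ, ∀ r ∈ 𝒜 i, φ r ∈ ℰ i)
    (hφker : LinearMap.ker φ = P)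
    (J : Submodule Rᵐᵒᵖ R)
    (hJhom : ∀ (i : ℤ) ⦃x : R⦄, x ∈ J → (DirectSum.decompose 𝒜 x i : R) ∈ J)
    (hi : ∀ (d : ℤ) (f : (R ⧸ J) →ₗ[Rᵐᵒᵖ] E),
        (∀ (i : ℤ) (x : R ⧸ J),
          x ∈ AddSubgroup.map J.mkQ.toAddMonoidHom (𝒜 i) → f x ∈ ℰ (i + d)) →
        f = 0)
    (a : R) (α : ℤ) (ha : a ∈ 𝒜 α) (L : Submodule Rᵐᵒᵖ R)
    (hLhom : ∀ (i : ℤ) ⦃x : R⦄, x ∈ L → (DirectSum.decompose 𝒜 x i : R) ∈ L)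
    (hLP : ¬ L ≤ P) : ∃ i, ∃ v ∈ 𝒜 i, v ∈ L ∧ a * v ∈ J ∧ v ∉ P := by
  by_contra hcon
  push Not at hcon
  have hdec := rg_decomp 𝒜 𝒜 (AddMonoidHom.mulLeft a) α (by
    intro i m hm
    rw [add_comm]; exact SetLike.mul_mem_graded ha hm)
  simp only [AddMonoidHom.coe_mulLeft] at hdec
  have hLK : ∀ v ∈ L, a * v ∈ J → φ v = 0 := by
    intro v hv hav
    have : ∀ i, (DirectSum.decompose 𝒜 v i : R) ∈ P := by
      intro i
      refine hcon i _ (SetLike.coe_mem _) (hLhom i hv) ?_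
      rw [← hdec]
      exact hJhom _ hav
    have hvP : v ∈ P := by
      classical
      rw [← DirectSum.sum_support_decompose 𝒜 v]
      exact P.sum_mem fun i _ => this i
    rwa [← hφker] at hvP
  let A' : Submodule Rᵐᵒᵖ R := L.map (LinearMap.mulLeft Rᵐᵒᵖ a) ⊔ J
  have hA' : ∀ x, x ∈ A' ↔ ∃ l ∈ L, x - a * l ∈ J := by
    intro x
    constructor
    · intro hx
      obtain ⟨_, ⟨l, hl, rfl⟩, j, hj, rfl⟩ := Submodule.mem_sup.1 hx
      exact ⟨l, hl, by simpa using hj⟩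
    · rintro ⟨l, hl, hj⟩
      exact Submodule.mem_sup.2 ⟨a * l, ⟨l, hl, rfl⟩, _, hj, by simp⟩
  have huniq : ∀ x l l', l ∈ L → l' ∈ L → x - a * l ∈ J → x - a * l' ∈ J → φ l = φ l' := by
    intro x l l' hl hl' h h'
    rw [← sub_eq_zero, ← map_sub]
    refine hLK _ (L.sub_mem hl hl') ?_
    have := J.sub_mem h' h
    convert this using 1
    rw [mul_sub]; abel
  choose! g hgL hgJ using fun x => (hA' x).1
  let f : A' →ₗ[Rᵐᵒᵖ] E :=
    { toFun := fun x => φ (g x)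
      map_add' := by
        intro x y
        rw [← map_add]
        refine huniq (x + y) _ _ (hgL _ (x + y).2) (L.add_mem (hgL _ x.2) (hgL _ y.2))
          (hgJ _ (x + y).2) ?_
        have := J.add_mem (hgJ _ x.2) (hgJ _ y.2)
        convert this using 1
        rw [mul_add]; abel
      map_smul' := by
        intro r x
        rw [RingHom.id_apply, ← map_smul]
        refine huniq (r • x : A') _ _ (hgL _ (r • x).2) (L.smul_mem r (hgL _ x.2))
          (hgJ _ (r • x).2) ?_
        have := J.smul_mem r (hgJ _ x.2)
        convert this using 1
        simp [smul_sub, MulOpposite.smul_eq_mul_unop, mul_assoc] }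
  have hf : ∀ (x : A') l, l ∈ L → (x : R) - a * l ∈ J → f x = φ l := fun x l hl h =>
    huniq x _ _ (hgL _ x.2) hl (hgJ _ x.2) h
  let _ := rgShiftDec 𝒜 α
  have hcomp : ∀ (x l : R) (i : ℤ), l ∈ L → x - a * l ∈ J →
      (DirectSum.decompose 𝒜 x (i + α) : R) - a * (DirectSum.decompose 𝒜 l i : R) ∈ J := by
    intro x l i hl h
    have := hJhom (i + α) h
    rw [DirectSum.decompose_sub, DirectSum.sub_apply, AddSubgroup.coe_sub, hdec] at this
    exact this
  obtain ⟨G, hGdeg, hG⟩ := hEinj R (rgShift 𝒜 α) (by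
      intro i j m r hm hr
      have := SetLike.mul_mem_graded (A := 𝒜) (i := i + α) hm hr
      change m * r ∈ 𝒜 (i + j + α)
      rwa [add_right_comm] at this) A' (by
      intro x hx i
      rw [rgShiftDec_apply]
      obtain ⟨l, hl, h⟩ := (hA' x).1 hx
      exact (hA' _).2 ⟨_, hLhom i hl, hcomp x l i hl h⟩) f (by
      intro i x hx
      obtain ⟨l, hl, h⟩ := (hA' x).1 x.2
      have h2 := hcomp x l i hl h
      rw [DirectSum.decompose_of_mem_same 𝒜 hx] at h2
      rw [hf x _ (hLhom i hl) h2]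
      exact hφdeg _ _ (SetLike.coe_mem _))
  have hGJ : J ≤ LinearMap.ker G := by
    intro j hj
    have hjA : j ∈ A' := (hA' j).2 ⟨0, L.zero_mem, by simpa using hj⟩
    have := hG ⟨j, hjA⟩
    rw [hf ⟨j, hjA⟩ 0 L.zero_mem (by simpa using hj), map_zero] at this
    exact this
  have h0 := hi (-α) (J.liftQ G hGJ) (by
    rintro i _ ⟨r, hr, rfl⟩
    change G r ∈ _
    apply hGdeg
    change r ∈ 𝒜 (i + -α + α)
    rw [neg_add_cancel_right]; exact hr)
  apply hLP
  intro l hl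
  rw [← hφker]
  have hlA : a * l ∈ A' := (hA' _).2 ⟨l, hl, by simp⟩
  have h1 := hG ⟨a * l, hlA⟩
  rw [hf ⟨a * l, hlA⟩ l hl (by simp)] at h1
  rw [LinearMap.mem_ker, ← h1]
  have := LinearMap.congr_fun h0 (J.mkQ (a * l))
  exact this

end RG2

theorem stmt5 {R : Type u} [Ring R] (𝒜 : ℤ → AddSubgroup R) [GradedRing 𝒜]
    -- `P` is a right ideal which is two-sided, homogeneous and prime
    (P : Submodule Rᵐᵒᵖ R)
    (hPleft : ∀ a ∈ P, ∀ r : R, r * a ∈ P)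
    (hPhom : ∀ (i : ℤ) ⦃x : R⦄, x ∈ P → (DirectSum.decompose 𝒜 x i : R) ∈ P)
    (hPne_top : P ≠ ⊤)
    (hPprime : ∀ a b : R, (∀ r : R, a * r * b ∈ P) → a ∈ P ∨ b ∈ P)
    -- `R/P` is right Noetherian: the right ideals of `R` containing `P` satisfy the ACC
    (hnoeth : ∀ c : ℕ →o Submodule Rᵐᵒᵖ R, (∀ k, P ≤ c k) →
      ∃ k, ∀ l, k ≤ l → c l = c k)
    -- `E` is a graded injective envelope of the graded right module `R/P`
    {E : Type u} [AddCommGroup E] [Module Rᵐᵒᵖ E] (ℰ : ℤ → AddSubgroup E)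
    [DirectSum.Decomposition ℰ] (hE : RGradedSMul 𝒜 ℰ)
    (hEinj : GradedInjective 𝒜 ℰ)
    (φ : R →ₗ[Rᵐᵒᵖ] E) (hφdeg : ∀ i : ℤ, ∀ r ∈ 𝒜 i, φ r ∈ ℰ i)
    (hφker : LinearMap.ker φ = P)
    (hφess : GradedEssential ℰ (LinearMap.range φ))
    -- `J` a homogeneous right ideal
    (J : Submodule Rᵐᵒᵖ R)
    (hJhom : ∀ (i : ℤ) ⦃x : R⦄, x ∈ J → (DirectSum.decompose 𝒜 x i : R) ∈ J) :
    (∀ (d : ℤ) (f : (R ⧸ J) →ₗ[Rᵐᵒᵖ] E),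
        (∀ (i : ℤ) (x : R ⧸ J),
          x ∈ AddSubgroup.map J.mkQ.toAddMonoidHom (𝒜 i) → f x ∈ ℰ (i + d)) →
        f = 0) ↔
    (∀ a : R, (∃ i : ℤ, a ∈ 𝒜 i) → ∃ c : R, MemCg 𝒜 P c ∧ a * c ∈ J) := by
  refine ⟨fun hi => ?_, fun h d f hf =>
    rg_ii_i 𝒜 P ℰ hE φ hφdeg hφker hφess J h d f hf⟩
  rintro a ⟨α, ha⟩
  let Pl : Ideal R :=
    { carrier := P
      add_mem' := fun hx hy => P.add_mem hx hy
      zero_mem' := P.zero_mem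
      smul_mem' := fun r x hx => hPleft x hx r }
  have hmemPl : ∀ x, x ∈ Pl ↔ x ∈ P := fun x => Iff.rfl
  have hPr : ∀ x ∈ P, ∀ r : R, x * r ∈ P := fun x hx r => P.smul_mem (op r) hx
  have : Pl.IsTwoSided := ⟨fun {x} r hx => hPr x hx r⟩
  let π : R →+* R ⧸ Pl := Ideal.Quotient.mk Pl
  have hπs : Function.Surjective π := Ideal.Quotient.mk_surjective
  have hπ0 : ∀ x, π x = 0 ↔ x ∈ P := fun x => Ideal.Quotient.eq_zero_iff_mem
  have : Nontrivial (R ⧸ Pl) := by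
    refine ⟨1, 0, fun h => hPne_top ?_⟩
    rw [← map_one π, hπ0] at h
    rw [eq_top_iff]
    intro x _
    simpa using hPr 1 h x
  have hprime : ∀ a b : R ⧸ Pl, (∀ r, a * r * b = 0) → a = 0 ∨ b = 0 := by
    intro a b h
    obtain ⟨a, rfl⟩ := hπs a
    obtain ⟨b, rfl⟩ := hπs b
    rw [hπ0, hπ0]
    apply hPprime
    intro r
    rw [← hπ0, map_mul, map_mul]
    exact h _
  have : IsNoetherian (R ⧸ Pl)ᵐᵒᵖ (R ⧸ Pl) := by
    rw [← monotone_stabilizes_iff_noetherian]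
    intro F
    let cm : Submodule (R ⧸ Pl)ᵐᵒᵖ (R ⧸ Pl) → Submodule Rᵐᵒᵖ R := fun N =>
      { carrier := {x | π x ∈ N}
        add_mem' := fun {x y} hx hy => by
          change π (x + y) ∈ N
          rw [map_add]; exact N.add_mem hx hy
        zero_mem' := by
          change π 0 ∈ N
          rw [map_zero]; exact N.zero_mem
        smul_mem' := fun r x hx => by
          change π (x * r.unop) ∈ N
          rw [map_mul]; exact N.smul_mem (op _) hx }
    have hcm : ∀ N x, x ∈ cm N ↔ π x ∈ N := fun N x => Iff.rfl
    obtain ⟨k, hk⟩ := hnoeth ⟨fun n => cm (F n), fun m n hmn x hx => F.monotone hmn hx⟩ (by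
      intro k x hx
      change π x ∈ F k
      rw [(hπ0 x).2 hx]; exact Submodule.zero_mem _)
    refine ⟨k, fun l hl => ?_⟩
    have h1 : cm (F l) = cm (F k) := hk l hl
    ext x
    obtain ⟨x, rfl⟩ := hπs x
    rw [← hcm, ← hcm, h1]
  let H : ℤ → R ⧸ Pl → Prop := fun i s => ∃ r ∈ 𝒜 i, π r = s
  have hH : RgGr H :=
    { one := ⟨1, SetLike.one_mem_graded 𝒜, map_one π⟩
      zero := fun i => ⟨0, zero_mem _, map_zero π⟩
      add := by
        rintro i _ _ ⟨a, ha, rfl⟩ ⟨b, hb, rfl⟩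
        exact ⟨a + b, add_mem ha hb, map_add π _ _⟩
      mul := by
        rintro i j _ _ ⟨a, ha, rfl⟩ ⟨b, hb, rfl⟩
        exact ⟨a * b, SetLike.mul_mem_graded ha hb, map_mul π _ _⟩
      span := by
        intro s
        obtain ⟨x, rfl⟩ := hπs s
        induction x using DirectSum.Decomposition.inductionOn 𝒜 with
        | zero => rw [map_zero]; exact zero_mem _
        | @homogeneous j m => exact AddSubgroup.subset_closure ⟨j, m, m.2, rfl⟩
        | add a b ha hb => rw [map_add]; exact add_mem ha hb }
  let I : Submodule (R ⧸ Pl)ᵐᵒᵖ (R ⧸ Pl) :=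
    { carrier := {s | ∃ r, a * r ∈ J ∧ π r = s}
      add_mem' := by
        rintro _ _ ⟨x, hx, rfl⟩ ⟨y, hy, rfl⟩
        exact ⟨x + y, by rw [mul_add]; exact J.add_mem hx hy, map_add π _ _⟩
      zero_mem' := ⟨0, by simp, map_zero π⟩
      smul_mem' := by
        rintro s _ ⟨x, hx, rfl⟩
        obtain ⟨t, ht⟩ := hπs s.unop
        refine ⟨x * t, ?_, ?_⟩
        · rw [← mul_assoc]; exact J.smul_mem (op t) hx
        · rw [map_mul, ht]; rfl }
  obtain ⟨c, d, ⟨r, hr, hrc⟩, ⟨k, hk, hkc⟩, hc1, hc2⟩ := rg_goldie hH hprime I (by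
    rintro _ d ⟨c, hc, rfl⟩ ⟨v, hv0, hv⟩
    obtain ⟨v, rfl⟩ := hπs v
    rw [← map_mul, hπ0] at hv
    rw [Ne, hπ0] at hv0
    let L : Submodule Rᵐᵒᵖ R := P.comap (LinearMap.mulLeft Rᵐᵒᵖ c)
    have hL : ∀ x, x ∈ L ↔ c * x ∈ P := fun x => Iff.rfl
    have hdec := rg_decomp 𝒜 𝒜 (AddMonoidHom.mulLeft c) d (by
      intro i m hm
      rw [add_comm]; exact SetLike.mul_mem_graded hc hm)
    simp only [AddMonoidHom.coe_mulLeft] at hdec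
    obtain ⟨i, w, hw, hwL, hwJ, hwP⟩ := rg_i_ess 𝒜 P ℰ hEinj φ hφdeg hφker J hJhom hi a α ha L
      (by
        intro i x hx
        rw [hL] at *
        rw [← hdec]
        exact hPhom _ hx)
      (fun h => hv0 (h hv))
    refine ⟨i, π w, ⟨w, hw, rfl⟩, ⟨w, hwJ, rfl⟩, by rwa [Ne, hπ0], ?_⟩
    rw [← map_mul, hπ0]; exact hwL)
  have hdec := rg_decomp 𝒜 𝒜 (AddMonoidHom.mulLeft a) α (by
    intro i m hm
    rw [add_comm]; exact SetLike.mul_mem_graded ha hm)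
  simp only [AddMonoidHom.coe_mulLeft] at hdec
  have hkd : π (DirectSum.decompose 𝒜 k d : R) = c := by
    have h1 : k - r ∈ P := by rw [← hπ0, map_sub, hkc, hrc, sub_self]
    have h2 := hPhom d h1
    rw [DirectSum.decompose_sub, DirectSum.sub_apply, AddSubgroup.coe_sub,
      DirectSum.decompose_of_mem_same 𝒜 hr, ← hπ0, map_sub, hrc, sub_eq_zero] at h2
    exact h2
  refine ⟨(DirectSum.decompose 𝒜 k d : R), ⟨⟨d, SetLike.coe_mem _⟩, ?_, ?_⟩, ?_⟩
  · intro x hx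
    rw [← hπ0, map_mul, hkd] at hx
    exact (hπ0 x).1 (hc1 _ hx)
  · intro x hx
    rw [← hπ0, map_mul, hkd] at hx
    exact (hπ0 x).1 (hc2 _ hx)
  · rw [← hdec]
    exact hJhom _ hk
end

section
/- Let K be a field and R a (not necessarily commutative) Noetherian positively graded connected K-algebra generated in degree one. Let P be a homogeneous two-sided prime ideal of R with P ≠ R_+, M a graded right R-module, and E a graded injective envelope of the graded right R-module R/P. Then Hom_{Gr}(M,E) = 0 (every degree-0 R-linear map M → E is zero) if and only if Hombar(M,E) = 0 (for every d ∈ ℤ, every degree-d R-linear map M → E is zero). -/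
/-!
STATEMENT 7: Let `K` be a field, `R` a (not necessarily commutative) Noetherian positively
graded connected `K`-algebra generated in degree one, `P` a homogeneous two-sided prime
ideal with `P ≠ R₊`, `M` a graded right `R`-module and `E` a graded injective envelope of
the graded right module `R/P` (encoded by a degree-0 right-linear map `φ : R → E` with
kernel `P` and graded essential range, `E` graded-injective).  Then `Hom_Gr(M, E) = 0`
iff `Hombar(M, E) = 0`.  Right modules are encoded as modules over `Rᵐᵒᵖ`.
-/

universe u

open DirectSum MulOpposite

section Helpers

variable {K : Type u} {R : Type u} [Field K] [Ring R] [Algebra K R]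

lemma aux_mul_right {P : Submodule Rᵐᵒᵖ R} {a : R} (ha : a ∈ P) (r : R) : a * r ∈ P :=
  P.smul_mem (op r) ha

lemma aux_one_not_mem {P : Submodule Rᵐᵒᵖ R} (hP : P ≠ ⊤) : (1 : R) ∉ P := by
  intro h
  apply hP
  rw [eq_top_iff]
  intro r _
  simpa using aux_mul_right h r

lemma aux_const (𝒜 : ℤ → AddSubgroup R)
    (hgen : Algebra.adjoin K ((𝒜 1 : AddSubgroup R) : Set R) = ⊤)
    (P : Submodule Rᵐᵒᵖ R) (hPleft : ∀ a ∈ P, ∀ r : R, r * a ∈ P) (y : R)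
    (hy : ∀ t ∈ 𝒜 1, t * y ∈ P) (r : R) : ∃ c : K, r * y - algebraMap K R c * y ∈ P := by
  have hr : r ∈ Algebra.adjoin K ((𝒜 1 : AddSubgroup R) : Set R) := by rw [hgen]; trivial
  induction hr using Algebra.adjoin_induction with
  | mem x hx => exact ⟨0, by simpa using hy x hx⟩
  | algebraMap c => exact ⟨c, by simp⟩
  | add a b _ _ ha hb =>
    obtain ⟨c, hc⟩ := ha
    obtain ⟨c', hc'⟩ := hb
    refine ⟨c + c', ?_⟩
    have := P.add_mem hc hc'
    convert this using 1
    rw [map_add]; noncomm_ring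
  | mul a b _ _ ha hb =>
    obtain ⟨c, hc⟩ := ha
    obtain ⟨c', hc'⟩ := hb
    refine ⟨c' * c, ?_⟩
    have := P.add_mem (hPleft _ hc' a) (hPleft _ hc (algebraMap K R c'))
    convert this using 1
    have h1 : a * (algebraMap K R c' * y) = algebraMap K R c' * (a * y) := by
      rw [← mul_assoc, ← Algebra.commutes c' a, mul_assoc]
    rw [map_mul, mul_sub, mul_sub, h1]; noncomm_ring

lemma aux_nonneg (𝒜 : ℤ → AddSubgroup R)
    (hpos : ∀ i : ℤ, i < 0 → 𝒜 i = ⊥) {x : R} {i : ℤ} (hx : x ∈ 𝒜 i) (h0 : x ≠ 0) : 0 ≤ i := by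
  by_contra! h
  rw [hpos i h] at hx
  exact h0 hx

lemma aux_step (𝒜 : ℤ → AddSubgroup R) [GradedRing 𝒜]
    (hpos : ∀ i : ℤ, i < 0 → 𝒜 i = ⊥)
    (hconn : 𝒜 0 = ((algebraMap K R).range).toAddSubgroup)
    (hgen : Algebra.adjoin K ((𝒜 1 : AddSubgroup R) : Set R) = ⊤)
    (P : Submodule Rᵐᵒᵖ R)
    (hPleft : ∀ a ∈ P, ∀ r : R, r * a ∈ P)
    (hPhom : ∀ (i : ℤ) ⦃x : R⦄, x ∈ P → (DirectSum.decompose 𝒜 x i : R) ∈ P)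
    (hPne_top : P ≠ ⊤)
    (hPprime : ∀ a b : R, (∀ r : R, a * r * b ∈ P) → a ∈ P ∨ b ∈ P)
    (hPne : P.toAddSubgroup ≠ ⨆ i : ℤ, ⨆ _ : 1 ≤ i, 𝒜 i)
    (y : R) (hy : y ∉ P) : ∃ t ∈ 𝒜 1, t * y ∉ P := by
  by_contra! hcon
  have h1 : ∀ t ∈ 𝒜 1, t ∈ P := by
    intro t ht
    refine (hPprime t y ?_).resolve_right hy
    intro r
    obtain ⟨c, hc⟩ := aux_const 𝒜 hgen P hPleft y hcon r
    have := P.add_mem (hPleft _ hc t) (hPleft _ (hcon t ht) (algebraMap K R c))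
    convert this using 1
    have h1 : t * (algebraMap K R c * y) = algebraMap K R c * (t * y) := by
      rw [← mul_assoc, ← Algebra.commutes c t, mul_assoc]
    rw [mul_sub, h1]; noncomm_ring
  have hone := aux_one_not_mem hPne_top
  have hK : ∀ c : K, algebraMap K R c ∈ P → c = 0 := by
    intro c hc
    by_contra h0
    apply hone
    have := hPleft _ hc (algebraMap K R c⁻¹)
    rwa [← map_mul, inv_mul_cancel₀ h0, map_one] at this
  have h0 : ∀ p ∈ P, (DirectSum.decompose 𝒜 p 0 : R) = 0 := by
    intro p hp
    have h2 : (DirectSum.decompose 𝒜 p 0 : R) ∈ ((algebraMap K R).range).toAddSubgroup := by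
      rw [← hconn]; exact SetLike.coe_mem _
    obtain ⟨c, hc⟩ := h2
    have h3 := hPhom 0 hp
    rw [← hc] at h3 ⊢
    rw [hK c h3, map_zero]
  apply hPne
  apply le_antisymm
  · intro p hp
    have hp' : p ∈ P := hp
    classical
    rw [← DirectSum.sum_support_decompose 𝒜 p]
    refine AddSubgroup.sum_mem _ fun i _ => ?_
    rcases lt_trichotomy i 0 with hi | hi | hi
    · have h2 := SetLike.coe_mem (DirectSum.decompose 𝒜 p i)
      have h3 : ((DirectSum.decompose 𝒜 p i : 𝒜 i) : R) = 0 := by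
        by_contra h3
        exact absurd (aux_nonneg 𝒜 hpos h2 h3) (by omega)
      rw [h3]
      exact AddSubgroup.zero_mem _
    · subst hi
      rw [h0 p hp']
      exact AddSubgroup.zero_mem _
    · exact (le_iSup₂_of_le (f := fun (i : ℤ) (_ : 1 ≤ i) => 𝒜 i) i hi le_rfl)
        (SetLike.coe_mem _)
  · refine iSup₂_le fun i hi r hr => ?_
    obtain ⟨c, hc⟩ := aux_const 𝒜 hgen P hPleft 1 (by simpa using h1) r
    rw [mul_one, mul_one] at hc
    have h2 := h0 _ hc
    have hc0 : algebraMap K R c ∈ 𝒜 0 := by rw [hconn]; exact ⟨c, rfl⟩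
    rw [DirectSum.decompose_sub, DirectSum.sub_apply, AddSubgroup.coe_sub,
      DirectSum.decompose_of_mem_same 𝒜 hc0,
      DirectSum.decompose_of_mem_ne 𝒜 hr (by omega), zero_sub, neg_eq_zero] at h2
    rw [h2, sub_zero] at hc
    exact hc

lemma aux_steps (𝒜 : ℤ → AddSubgroup R) [GradedRing 𝒜] (P : Submodule Rᵐᵒᵖ R)
    (hstep : ∀ y : R, y ∉ P → ∃ t ∈ 𝒜 1, t * y ∉ P)
    (n : ℕ) (y : R) (hy : y ∉ P) : ∃ t ∈ 𝒜 n, t * y ∉ P := by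
  induction n with
  | zero => exact ⟨1, SetLike.one_mem_graded 𝒜, by simpa using hy⟩
  | succ n ih =>
    obtain ⟨t, ht, hty⟩ := ih
    obtain ⟨t', ht', h⟩ := hstep _ hty
    refine ⟨t' * t, ?_, by rwa [mul_assoc]⟩
    have := SetLike.mul_mem_graded ht' ht
    convert this using 2
    push_cast; ring

/-- right annihilator modulo `P` -/
def annP (P : Submodule Rᵐᵒᵖ R) (a : R) : Submodule Rᵐᵒᵖ R where
  carrier := {r | a * r ∈ P}
  add_mem' := by
    intro x y hx hy
    simpa [mul_add] using P.add_mem hx hy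
  zero_mem' := by simp
  smul_mem' := by
    intro c x hx
    have := P.smul_mem c hx
    induction c using MulOpposite.rec' with
    | _ c => simpa [mul_assoc] using this

lemma mem_annP {P : Submodule Rᵐᵒᵖ R} {a r : R} : r ∈ annP P a ↔ a * r ∈ P := Iff.rfl

lemma aux_noeth [IsNoetherianRing Rᵐᵒᵖ] : IsNoetherian Rᵐᵒᵖ R := by
  let e : Rᵐᵒᵖ ≃ₗ[Rᵐᵒᵖ] R :=
    { MulOpposite.opAddEquiv.symm with
      map_smul' := by intro a b; simp }
  exact isNoetherian_of_linearEquiv e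

lemma aux_pow (x v s : R) (k : ℕ) :
    (x * (v * s)) ^ (k + 1) = x * v * (s * (x * v)) ^ k * s := by
  induction k with
  | zero => simp [mul_assoc]
  | succ k ih => rw [pow_succ, ih, pow_succ (s * (x * v))]; simp only [mul_assoc]

lemma aux_nonnil [IsNoetherianRing Rᵐᵒᵖ] (𝒜 : ℤ → AddSubgroup R) [GradedRing 𝒜]
    (hpos : ∀ i : ℤ, i < 0 → 𝒜 i = ⊥)
    (P : Submodule Rᵐᵒᵖ R)
    (hPleft : ∀ a ∈ P, ∀ r : R, r * a ∈ P)
    (hPne_top : P ≠ ⊤)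
    (hPprime : ∀ a b : R, (∀ r : R, a * r * b ∈ P) → a ∈ P ∨ b ∈ P)
    (hstep : ∀ y : R, y ∉ P → ∃ t ∈ 𝒜 1, t * y ∉ P)
    {j : ℤ} (s : R) (hs : s ∈ 𝒜 j) (hsP : s ∉ P) :
    ∃ (l : ℤ) (u : R), u ∈ 𝒜 l ∧ 0 < j + l ∧ ∀ k : ℕ, (s * u) ^ k ∉ P := by
  by_contra! hcon
  have hN : IsNoetherian Rᵐᵒᵖ R := aux_noeth
  have hone := aux_one_not_mem hPne_top
  let S : Set (Submodule Rᵐᵒᵖ R) :=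
    {I | ∃ (e : ℤ) (v : R), v ∈ 𝒜 e ∧ v * s ∉ P ∧ annP P (v * s) = I}
  have hS : S.Nonempty := ⟨_, 0, 1, SetLike.one_mem_graded 𝒜, by simpa using hsP, rfl⟩
  obtain ⟨I, ⟨e, v, hv, hvP, rfl⟩, hmax⟩ := set_has_maximal_iff_noetherian.2 hN S hS
  have hs0 : s ≠ 0 := fun h => hsP (h ▸ P.zero_mem)
  have hv0 : v ≠ 0 := fun h => hvP (by rw [h, zero_mul]; exact P.zero_mem)
  have hj := aux_nonneg 𝒜 hpos hs hs0
  have he := aux_nonneg 𝒜 hpos hv hv0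
  have key : ∀ (q : ℤ) (x : R), 1 ≤ q → x ∈ 𝒜 q → (v * s) * (x * (v * s)) ∈ P := by
    intro q x hq hx
    have hnil : ∃ k : ℕ, (x * (v * s)) ^ k ∈ P := by
      obtain ⟨k, hk⟩ := hcon (q + e) (x * v) (SetLike.mul_mem_graded hx hv) (by omega)
      exact ⟨k + 1, by rw [aux_pow]; exact aux_mul_right (hPleft _ hk _) _⟩
    classical
    have hk := Nat.find_spec hnil
    have hmin : ∀ m < Nat.find hnil, (x * (v * s)) ^ m ∉ P := fun m hm => Nat.find_min hnil hm
    generalize Nat.find hnil = k at hk hmin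
    match k, hk, hmin with
    | 0, hk, _ => exact absurd (by simpa using hk) hone
    | 1, hk, _ => exact hPleft _ (by simpa using hk) _
    | k + 2, hk, hmin =>
      have hb := hmin (k + 1) (by omega)
      have hbeq : (x * (v * s)) ^ (k + 1) = ((x * (v * s)) ^ k * (x * v)) * s := by
        rw [pow_succ]; simp only [mul_assoc]
      have hmem : annP P ((x * (v * s)) ^ (k + 1)) ∈ S := by
        refine ⟨k • (q + (e + j)) + (q + e), (x * (v * s)) ^ k * (x * v), ?_, by rwa [← hbeq], by rw [← hbeq]⟩
        exact SetLike.mul_mem_graded (SetLike.pow_mem_graded k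
          (SetLike.mul_mem_graded hx (SetLike.mul_mem_graded hv hs)))
          (SetLike.mul_mem_graded hx hv)
      have hle : annP P (v * s) ≤ annP P ((x * (v * s)) ^ (k + 1)) := by
        intro r hr
        rw [mem_annP] at hr ⊢
        have := hPleft _ hr ((x * (v * s)) ^ k * x)
        rw [pow_succ]
        simpa only [mul_assoc] using this
      have heq := eq_of_le_of_not_lt hle (hmax _ hmem)
      rw [← mem_annP, heq, mem_annP, ← pow_succ]
      exact hk
  obtain ⟨t, ht, htP⟩ := hstep _ hvP
  refine (hPprime (v * s) (t * (v * s)) ?_).elim hvP htP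
  intro r
  classical
  rw [← DirectSum.sum_support_decompose 𝒜 r, Finset.mul_sum, Finset.sum_mul]
  refine P.sum_mem fun i _ => ?_
  have hi := SetLike.coe_mem (DirectSum.decompose 𝒜 r i)
  generalize ((DirectSum.decompose 𝒜 r i : 𝒜 i) : R) = z at hi
  by_cases hz : z = 0
  · simp [hz]
  have hi0 := aux_nonneg 𝒜 hpos hi hz
  have := key (i + 1) (z * t) (by omega) (SetLike.mul_mem_graded hi ht)
  simpa only [mul_assoc] using this

lemma aux_main [IsNoetherianRing Rᵐᵒᵖ] (𝒜 : ℤ → AddSubgroup R) [GradedRing 𝒜]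
    (hpos : ∀ i : ℤ, i < 0 → 𝒜 i = ⊥)
    (P : Submodule Rᵐᵒᵖ R)
    (hPleft : ∀ a ∈ P, ∀ r : R, r * a ∈ P)
    (hPne_top : P ≠ ⊤)
    (hPprime : ∀ a b : R, (∀ r : R, a * r * b ∈ P) → a ∈ P ∨ b ∈ P)
    (hstep : ∀ y : R, y ∉ P → ∃ t ∈ 𝒜 1, t * y ∉ P)
    {j : ℤ} (s : R) (hs : s ∈ 𝒜 j) (hsP : s ∉ P) (d : ℤ) :
    ∃ (l : ℤ) (r y : R), r ∈ 𝒜 l ∧ y ∈ 𝒜 (j + l - d) ∧ y ∉ P ∧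
      ∀ t, s * r * t ∈ P → y * t ∈ P := by
  obtain ⟨l, u, hu, hl, hnil⟩ := aux_nonnil 𝒜 hpos P hPleft hPne_top hPprime hstep s hs hsP
  have hN : IsNoetherian Rᵐᵒᵖ R := aux_noeth
  let F : ℕ →o Submodule Rᵐᵒᵖ R :=
    { toFun := fun k => annP P ((s * u) ^ k)
      monotone' := by
        refine monotone_nat_of_le_succ fun k r hr => ?_
        rw [mem_annP] at hr ⊢
        rw [pow_succ', mul_assoc]
        exact hPleft _ hr _ }
  obtain ⟨N, hNs⟩ := monotone_stabilizes_iff_noetherian.2 hN F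
  set n := (j + l).toNat with hn
  have hn' : (n : ℤ) = j + l := by omega
  have hd : (0 : ℤ) ≤ (d.toNat + 1 : ℕ) * (j + l) - d := by
    have h1 : d ≤ d.toNat := Int.self_le_toNat d
    push_cast
    nlinarith
  obtain ⟨t, ht, htP⟩ := aux_steps 𝒜 P hstep ((d.toNat + 1 : ℕ) * (j + l) - d).toNat
    ((s * u) ^ N) (hnil N)
  rw [Int.toNat_of_nonneg hd] at ht
  have hsu : s * u ∈ 𝒜 (j + l) := SetLike.mul_mem_graded hs hu
  refine ⟨l + (N + d.toNat) • (j + l), u * (s * u) ^ (N + d.toNat), t * (s * u) ^ N,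
    SetLike.mul_mem_graded hu (SetLike.pow_mem_graded _ hsu), ?_, htP, ?_⟩
  · have := SetLike.mul_mem_graded ht (SetLike.pow_mem_graded N hsu)
    convert this using 2
    simp only [nsmul_eq_mul]
    push_cast
    ring
  · intro z hz
    have h1 : z ∈ F (N + d.toNat + 1) := by
      change (s * u) ^ (N + d.toNat + 1) * z ∈ P
      rw [pow_succ']
      simpa only [mul_assoc] using hz
    rw [← hNs (N + d.toNat + 1) (by omega)] at h1
    rw [mul_assoc]
    exact hPleft _ h1 _

lemma aux_decomp {A B : Type u} [AddCommGroup A] [AddCommGroup B] (𝒜 : ℤ → AddSubgroup A)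
    [DirectSum.Decomposition 𝒜] (ℬ : ℤ → AddSubgroup B) [DirectSum.Decomposition ℬ]
    (g : A →+ B) (e : ℤ) (hg : ∀ i, ∀ a ∈ 𝒜 i, g a ∈ ℬ (e + i)) (a : A) (k : ℤ) :
    (DirectSum.decompose ℬ (g a) k : B) = g (DirectSum.decompose 𝒜 a (k - e) : A) := by
  induction a using DirectSum.Decomposition.inductionOn 𝒜 with
  | zero => simp
  | @homogeneous i a =>
    by_cases h : k = e + i
    · subst h
      rw [DirectSum.decompose_of_mem_same ℬ (hg i a a.2)]
      have : e + i - e = i := by ring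
      rw [this, DirectSum.decompose_of_mem_same 𝒜 a.2]
    · rw [DirectSum.decompose_of_mem_ne ℬ (hg i a a.2) (by omega),
        DirectSum.decompose_of_mem_ne 𝒜 a.2 (by omega), map_zero]
  | add a b ha hb =>
    simp only [map_add, DirectSum.decompose_add, DirectSum.add_apply, AddSubgroup.coe_add, ha, hb]

/-- the map `r ↦ m r` -/
def orbitMap {M : Type u} [AddCommGroup M] [Module Rᵐᵒᵖ M] (m : M) : R →ₗ[Rᵐᵒᵖ] M where
  toFun r := op r • m
  map_add' := by intro a b; simp [add_smul]
  map_smul' := by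
    intro c x
    induction c using MulOpposite.rec' with
    | _ c => simp [mul_smul]

lemma orbitMap_apply {M : Type u} [AddCommGroup M] [Module Rᵐᵒᵖ M] (m : M) (r : R) :
    orbitMap m r = op r • m := rfl

lemma orbit_graded (𝒜 : ℤ → AddSubgroup R) [GradedRing 𝒜]
    {M : Type u} [AddCommGroup M] [Module Rᵐᵒᵖ M] (ℳ : ℤ → AddSubgroup M)
    [DirectSum.Decomposition ℳ] (hM : RGradedSMul 𝒜 ℳ) {i : ℤ} {m : M} (hm : m ∈ ℳ i)
    (r : R) (k : ℤ) : (DirectSum.decompose ℳ (op r • m) k : M) =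
      op (DirectSum.decompose 𝒜 r (k - i) : R) • m :=
  aux_decomp 𝒜 ℳ (orbitMap m : R →ₗ[Rᵐᵒᵖ] M).toAddMonoidHom i (fun _ _ ha => hM hm ha) r k

lemma orbit_isGraded (𝒜 : ℤ → AddSubgroup R) [GradedRing 𝒜]
    {M : Type u} [AddCommGroup M] [Module Rᵐᵒᵖ M] (ℳ : ℤ → AddSubgroup M)
    [DirectSum.Decomposition ℳ] (hM : RGradedSMul 𝒜 ℳ) {i : ℤ} {m : M} (hm : m ∈ ℳ i) :
    IsGradedSubmodule ℳ (LinearMap.range (orbitMap m : R →ₗ[Rᵐᵒᵖ] M)) := by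
  rintro _ ⟨r, rfl⟩ k
  rw [orbitMap_apply, orbit_graded 𝒜 ℳ hM hm]
  exact ⟨_, rfl⟩

end Helpers

theorem stmt7 {K : Type u} {R : Type u} [Field K] [Ring R] [Algebra K R]
    -- Noetherian (on both sides)
    [IsNoetherianRing R] [IsNoetherianRing Rᵐᵒᵖ]
    (𝒜 : ℤ → AddSubgroup R) [GradedRing 𝒜]
    -- positively graded
    (hpos : ∀ i : ℤ, i < 0 → 𝒜 i = ⊥)
    -- connected: `R₀ = K`
    (hconn : 𝒜 0 = ((algebraMap K R).range).toAddSubgroup)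
    -- generated in degree one
    (hgen : Algebra.adjoin K ((𝒜 1 : AddSubgroup R) : Set R) = ⊤)
    -- `P` a homogeneous two-sided prime ideal (as a right ideal closed under left
    -- multiplication), different from the irrelevant ideal `⊕_{i ≥ 1} R_i`
    (P : Submodule Rᵐᵒᵖ R)
    (hPleft : ∀ a ∈ P, ∀ r : R, r * a ∈ P)
    (hPhom : ∀ (i : ℤ) ⦃x : R⦄, x ∈ P → (DirectSum.decompose 𝒜 x i : R) ∈ P)
    (hPne_top : P ≠ ⊤)
    (hPprime : ∀ a b : R, (∀ r : R, a * r * b ∈ P) → a ∈ P ∨ b ∈ P)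
    (hPne : P.toAddSubgroup ≠ ⨆ i : ℤ, ⨆ _ : 1 ≤ i, 𝒜 i)
    -- `M` a graded right `R`-module
    {M : Type u} [AddCommGroup M] [Module Rᵐᵒᵖ M] (ℳ : ℤ → AddSubgroup M)
    [DirectSum.Decomposition ℳ] (hM : RGradedSMul 𝒜 ℳ)
    -- `E` a graded injective envelope of the graded right module `R/P`
    {E : Type u} [AddCommGroup E] [Module Rᵐᵒᵖ E] (ℰ : ℤ → AddSubgroup E)
    [DirectSum.Decomposition ℰ] (hE : RGradedSMul 𝒜 ℰ)
    (hEinj : GradedInjective 𝒜 ℰ)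
    (φ : R →ₗ[Rᵐᵒᵖ] E) (hφdeg : ∀ i : ℤ, ∀ r ∈ 𝒜 i, φ r ∈ ℰ i)
    (hφker : LinearMap.ker φ = P)
    (hφess : GradedEssential ℰ (LinearMap.range φ)) :
    (∀ f : M →ₗ[Rᵐᵒᵖ] E, (∀ i : ℤ, ∀ m ∈ ℳ i, f m ∈ ℰ i) → f = 0) ↔
    (∀ (d : ℤ) (f : M →ₗ[Rᵐᵒᵖ] E), (∀ i : ℤ, ∀ m ∈ ℳ i, f m ∈ ℰ (i + d)) → f = 0) := by
  have hstep := aux_step 𝒜 hpos hconn hgen P hPleft hPhom hPne_top hPprime hPne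
  constructor
  swap
  · intro h f hf
    exact h 0 f (by simpa using hf)
  intro h d f hf
  by_contra hf0
  -- a homogeneous element not killed by `f`
  obtain ⟨i, m, hm, hfm⟩ : ∃ (i : ℤ) (m : M), m ∈ ℳ i ∧ f m ≠ 0 := by
    by_contra! hc
    apply hf0
    ext x
    classical
    rw [← DirectSum.sum_support_decompose ℳ x, map_sum]
    exact Finset.sum_eq_zero fun i _ => hc i _ (SetLike.coe_mem _)
  have hfm' := hf i m hm
  have hne := hφess _ (orbit_isGraded 𝒜 ℰ hE hfm') (by
    intro hb
    apply hfm
    have : f m ∈ LinearMap.range (orbitMap (f m) : R →ₗ[Rᵐᵒᵖ] E) :=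
      ⟨1, by rw [orbitMap_apply]; simp⟩
    rw [hb] at this
    exact this)
  obtain ⟨x, ⟨⟨r, hr⟩, ⟨s, hs⟩⟩, hx0⟩ := Submodule.exists_mem_ne_zero_of_ne_bot hne
  rw [orbitMap_apply] at hr
  obtain ⟨k, hk⟩ : ∃ k : ℤ, (DirectSum.decompose ℰ x k : E) ≠ 0 := by
    by_contra! hc
    apply hx0
    classical
    rw [← DirectSum.sum_support_decompose ℰ x]
    exact Finset.sum_eq_zero fun i _ => hc i
  have e1 : (DirectSum.decompose ℰ x k : E) =
      op (DirectSum.decompose 𝒜 r (k - (i + d)) : R) • f m := by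
    rw [← hr]; exact orbit_graded 𝒜 ℰ hE hfm' r k
  have e2 : (DirectSum.decompose ℰ x k : E) = φ (DirectSum.decompose 𝒜 s k : R) := by
    rw [← hs]
    have := aux_decomp 𝒜 ℰ φ.toAddMonoidHom 0 (by simpa using hφdeg) s k
    rw [sub_zero] at this
    exact this
  have hr' := SetLike.coe_mem (DirectSum.decompose 𝒜 r (k - (i + d)))
  have hs' := SetLike.coe_mem (DirectSum.decompose 𝒜 s k)
  rw [e2] at e1 hk
  generalize ((DirectSum.decompose 𝒜 r (k - (i + d)) : 𝒜 _) : R) = r' at e1 hr'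
  generalize ((DirectSum.decompose 𝒜 s k : 𝒜 _) : R) = s' at e1 hs' hk
  have hker : ∀ z : R, z ∈ P ↔ φ z = 0 := by
    intro z; rw [← hφker, LinearMap.mem_ker]
  obtain ⟨l, q, y, hq, hy, hyP, hann⟩ := aux_main 𝒜 hpos P hPleft hPne_top hPprime hstep
    s' hs' (by rwa [hker]) d
  have hφr : ∀ a b : R, φ (a * b) = op b • φ a := fun a b => φ.map_smul (op b) a
  set m' : M := op q • op r' • m with hm'def
  have hm' : m' ∈ ℳ (k + l - d) := by
    have := hM (hM hm hr') hq
    convert this using 2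
    ring
  have hfm2 : f m' = φ (s' * q) := by
    rw [hm'def, map_smul, map_smul, ← e1, hφr]
  let ψ : R →ₗ[Rᵐᵒᵖ] M := orbitMap m'
  let g0 : R →ₗ[Rᵐᵒᵖ] E := orbitMap (φ y)
  have hle : LinearMap.ker ψ ≤ LinearMap.ker g0 := by
    intro z hz
    rw [LinearMap.mem_ker] at hz ⊢
    change op z • m' = 0 at hz
    change op z • φ y = 0
    rw [← hφr, ← hker]
    apply hann
    rw [hker, hφr, ← hfm2, ← map_smul, hz, map_zero]
  let g1 : LinearMap.range ψ →ₗ[Rᵐᵒᵖ] E :=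
    (Submodule.liftQ _ g0 hle).comp ψ.quotKerEquivRange.symm.toLinearMap
  have hg1 : ∀ (z : R) (hz : op z • m' ∈ LinearMap.range ψ), g1 ⟨op z • m', hz⟩ = op z • φ y := by
    intro z hz
    have : ψ.quotKerEquivRange.symm ⟨op z • m', hz⟩ = Submodule.Quotient.mk z := by
      rw [LinearEquiv.symm_apply_eq]
      rfl
    change (Submodule.liftQ _ g0 hle) (ψ.quotKerEquivRange.symm ⟨op z • m', hz⟩) = _
    rw [this]
    rfl
  obtain ⟨g, hgdeg, hg⟩ := hEinj M ℳ hM (LinearMap.range ψ) (orbit_isGraded 𝒜 ℳ hM hm') g1 (by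
    rintro p ⟨_, z, rfl⟩ hz
    change op z • m' ∈ ℳ p at hz
    have hz1 := orbit_graded 𝒜 ℳ hM hm' z p
    rw [DirectSum.decompose_of_mem_same ℳ hz] at hz1
    have h2 : g1 ⟨ψ z, ⟨z, rfl⟩⟩ = op (DirectSum.decompose 𝒜 z (p - (k + l - d)) : R) • φ y := by
      rw [← hg1 _ ⟨_, rfl⟩]
      congr 1
      exact Subtype.ext hz1
    rw [h2]
    have := hE (hφdeg _ _ hy) (SetLike.coe_mem (DirectSum.decompose 𝒜 z (p - (k + l - d))))
    convert this using 2
    ring)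
  have hg0 := h g hgdeg
  apply hyP
  rw [hker]
  have h3 := (hg ⟨op (1 : R) • m', ⟨1, rfl⟩⟩).trans (hg1 1 ⟨1, rfl⟩)
  rw [hg0] at h3
  simpa using h3.symm
end

section
/- Let R be a commutative local ring with maximal ideal m, let X• be a bounded cochain complex of finitely generated free R-modules, let Y• := (R/m) ⊗_R X•, and fix an integer α. If H^j(Y•) = 0 for all j ≥ α, then H^j(X•) = 0 for all j ≥ α. -/
/-!
STATEMENT 15: Let `R` be a commutative local ring with maximal ideal `m`, `X•` a bounded
cochain complex of finitely generated free `R`-modules and `Y• := (R/m) ⊗_R X•`.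
If `H^j(Y•) = 0` for all `j ≥ α` then `H^j(X•) = 0` for all `j ≥ α`.
(Vanishing of `H^j` is expressed as exactness: `ker d^j ⊆ im d^{j-1}`.)
-/

open TensorProduct

theorem aux15 {R : Type*} [CommRing R] [IsLocalRing R] {A B C : Type*}
    [AddCommGroup A] [AddCommGroup B] [AddCommGroup C] [Module R A] [Module R B] [Module R C]
    [Module.Finite R B] [Module.Free R B]
    (f : A →ₗ[R] B) (g : B →ₗ[R] C) (hgf : g.comp f = 0)
    (hY : ∀ y : (R ⧸ IsLocalRing.maximalIdeal R) ⊗[R] B,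
        LinearMap.lTensor (R ⧸ IsLocalRing.maximalIdeal R) g y = 0 →
        ∃ z : (R ⧸ IsLocalRing.maximalIdeal R) ⊗[R] A,
          LinearMap.lTensor (R ⧸ IsLocalRing.maximalIdeal R) f z = y)
    (hp : ∃ p : B →ₗ[R] B, (∀ x, g (p x) = 0) ∧ ∀ x, g x = 0 → p x = x) :
    (∀ x, g x = 0 → ∃ z, f z = x) ∧
      ∃ p : A →ₗ[R] A, (∀ x, f (p x) = 0) ∧ ∀ x, f x = 0 → p x = x := by
  obtain ⟨p, hp1, hp2⟩ := hp
  have hK : LinearMap.range p = LinearMap.ker g := by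
    ext x
    constructor
    · rintro ⟨y, rfl⟩
      exact hp1 y
    · intro hx
      exact ⟨x, hp2 x hx⟩
  have hfg : (LinearMap.ker g).FG := by
    rw [← hK, LinearMap.range_eq_map]
    exact Submodule.FG.map _ Module.Finite.fg_top
  have hle : LinearMap.ker g ≤ LinearMap.range f := by
    apply Submodule.le_of_le_smul_of_le_jacobson_bot (I := IsLocalRing.maximalIdeal R) hfg
      (IsLocalRing.maximalIdeal_le_jacobson _)
    intro x hx
    have hx0 : g x = 0 := hx
    obtain ⟨z, hz⟩ := hY (1 ⊗ₜ x) (by simp [hx0])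
    obtain ⟨z, rfl⟩ := TensorProduct.mk_surjective R A (R ⧸ IsLocalRing.maximalIdeal R)
      Ideal.Quotient.mk_surjective z
    have h1 : (1 : R ⧸ IsLocalRing.maximalIdeal R) ⊗ₜ[R] (x - f z) = 0 := by
      rw [TensorProduct.tmul_sub, ← hz]
      simp
    have h2 : x - f z ∈ IsLocalRing.maximalIdeal R • (⊤ : Submodule R B) := by
      have h3 := congrArg (TensorProduct.quotTensorEquivQuotSMul B (IsLocalRing.maximalIdeal R)) h1
      rw [map_zero] at h3
      have h4 := TensorProduct.quotTensorEquivQuotSMul_mk_tmul (IsLocalRing.maximalIdeal R)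
        (1 : R) (x - f z)
      rw [map_one, one_smul, h3] at h4
      exact (Submodule.Quotient.mk_eq_zero _).1 h4.symm
    have h5 : p (x - f z) = x - f z := hp2 _ (by
      have := LinearMap.congr_fun hgf z
      simp at this
      simp [hx0, this])
    have h6 := Submodule.mem_map_of_mem (f := p) h2
    rw [Submodule.map_smul'', ← LinearMap.range_eq_map, hK, h5] at h6
    exact Submodule.mem_sup.2 ⟨f z, ⟨z, rfl⟩, x - f z, h6, by abel⟩
  refine ⟨fun x hx => hle hx, ?_⟩
  -- lift `p` along `f`
  have hpl : ∀ y, p y ∈ LinearMap.range f := fun y => hle (hp1 y)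
  obtain ⟨s, hs⟩ := Module.projective_lifting_property f.rangeRestrict (p.codRestrict _ hpl)
    f.surjective_rangeRestrict
  have hs1 : ∀ y, f (s y) = p y := fun y => congrArg Subtype.val (LinearMap.congr_fun hs y)
  refine ⟨LinearMap.id - s.comp f, fun x => ?_, fun x hx => by simp [hx]⟩
  have h7 : g (f x) = 0 := LinearMap.congr_fun hgf x
  simp [hs1, hp2 _ h7]

theorem stmt15 {R : Type*} [CommRing R] [IsLocalRing R]
    -- a bounded cochain complex of finitely generated free `R`-modules
    (X : ℤ → Type*) [∀ k, AddCommGroup (X k)] [∀ k, Module R (X k)]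
    [∀ k, Module.Finite R (X k)] [∀ k, Module.Free R (X k)]
    (d : ∀ k : ℤ, X k →ₗ[R] X (k + 1))
    (hdd : ∀ k : ℤ, (d (k + 1)).comp (d k) = 0)
    (hbdd : ∃ N : ℤ, ∀ k : ℤ, N ≤ |k| → Subsingleton (X k))
    (α : ℤ)
    -- `H^j((R/m) ⊗ X•) = 0` for all `j ≥ α`
    (hY : ∀ k : ℤ, α ≤ k + 1 →
      ∀ y : (R ⧸ IsLocalRing.maximalIdeal R) ⊗[R] X (k + 1),
        LinearMap.lTensor (R ⧸ IsLocalRing.maximalIdeal R) (d (k + 1)) y = 0 →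
        ∃ z : (R ⧸ IsLocalRing.maximalIdeal R) ⊗[R] X k,
          LinearMap.lTensor (R ⧸ IsLocalRing.maximalIdeal R) (d k) z = y) :
    -- `H^j(X•) = 0` for all `j ≥ α`
    ∀ k : ℤ, α ≤ k + 1 → ∀ x : X (k + 1), d (k + 1) x = 0 → ∃ z : X k, d k z = x := by
  obtain ⟨N, hN⟩ := hbdd
  have key : ∀ n : ℕ, ∀ k : ℤ, N ≤ k + n → 0 ≤ k + n → α ≤ k →
      ∃ p : X k →ₗ[R] X k, (∀ x, d k (p x) = 0) ∧ ∀ x, d k x = 0 → p x = x := by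
    intro n
    induction n with
    | zero =>
      intro k h1 h2 h3
      have := hN k (by rw [abs_of_nonneg (by simpa using h2)]; simpa using h1)
      exact ⟨0, by simp, fun x _ => Subsingleton.elim _ _⟩
    | succ n ih =>
      intro k h1 h2 h3
      push_cast at h1 h2
      exact (aux15 (d k) (d (k + 1)) (hdd k) (hY k (by omega))
        (ih (k + 1) (by omega) (by omega) (by omega))).2
  intro k hk
  exact (aux15 (d k) (d (k + 1)) (hdd k) (hY k hk)
    (key (N.natAbs + k.natAbs + 1) (k + 1) (by omega) (by omega) hk)).1
end

section
/- Let K be a field and R a commutative local K-algebra with maximal ideal m such that the composite K → R → R/m is an isomorphism. Let X• be a bounded cochain complex of finitely generated free R-modules, let Z• := K ⊗_R X• (where K is an R-module via the quotient map R → R/m ≅ K), and fix an integer α. If H^j(Z•) = 0 for all j ≥ α, then H^j(X•) = 0 for all j ≥ α. -/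
/-!
STATEMENT 16: Let `K` be a field and `R` a commutative local `K`-algebra with maximal
ideal `m` such that the composite `K → R → R/m` is an isomorphism.  `K` is an `R`-module
via `R → R/m ≅ K` (encoded by a module structure `[Module R K]` satisfying the two
characterizing identities below).  If `X•` is a bounded cochain complex of finitely
generated free `R`-modules, `Z• := K ⊗_R X•` and `H^j(Z•) = 0` for all `j ≥ α`, then
`H^j(X•) = 0` for all `j ≥ α`.
(Vanishing of `H^j` is expressed as exactness: `ker d^j ⊆ im d^{j-1}`.)
-/

open TensorProduct

theorem aux_step_s16 {K R : Type*} [Field K] [CommRing R] [Algebra K R] [IsLocalRing R]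
    [Module R K]
    (hact₁ : ∀ c x : K, (algebraMap K R c) • x = c * x)
    {A B C : Type*} [AddCommGroup A] [Module R A] [AddCommGroup B] [Module R B]
    [AddCommGroup C] [Module R C] [Module.Finite R B] [Module.Free R B]
    (f : A →ₗ[R] B) (g : B →ₗ[R] C) (hgf : g.comp f = 0)
    (hZ : ∀ y : K ⊗[R] B, LinearMap.lTensor K g y = 0 → ∃ z : K ⊗[R] A, LinearMap.lTensor K f z = y)
    (p : B →ₗ[R] B) (hp : ∀ x, g (p x) = 0) (hp' : ∀ x, g x = 0 → p x = x) :
    (∀ x, g x = 0 → ∃ z, f z = x) ∧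
    ∃ q : A →ₗ[R] A, (∀ x, f (q x) = 0) ∧ ∀ x, f x = 0 → q x = x := by
  have hone : ∀ z : K ⊗[R] A, ∃ a : A, (1 : K) ⊗ₜ[R] a = z := by
    intro z
    induction z using TensorProduct.induction_on with
    | zero => exact ⟨0, by simp⟩
    | tmul c x =>
      refine ⟨algebraMap K R c • x, ?_⟩
      rw [← TensorProduct.smul_tmul, hact₁, mul_one]
    | add x y hx hy =>
      obtain ⟨a, rfl⟩ := hx
      obtain ⟨b, rfl⟩ := hy
      exact ⟨a + b, by rw [TensorProduct.tmul_add]⟩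
  have hm : ∀ x : B, (1 : K) ⊗ₜ[R] x = 0 → x ∈ IsLocalRing.maximalIdeal R • (⊤ : Submodule R B) := by
    intro x hx
    let b := Module.Free.chooseBasis R B
    rw [← b.sum_repr x]
    refine Submodule.sum_mem _ fun i _ => Submodule.smul_mem_smul ?_ Submodule.mem_top
    have h1 := congrArg (fun t => TensorProduct.rid R K (LinearMap.lTensor K (b.coord i) t)) hx
    simp only [LinearMap.lTensor_tmul, TensorProduct.rid_tmul, map_zero, Module.Basis.coord_apply] at h1
    rw [IsLocalRing.mem_maximalIdeal, mem_nonunits_iff]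
    intro hu
    exact one_ne_zero (hu.smul_eq_zero.mp h1)
  have hgf' : ∀ a, g (f a) = 0 := fun a => LinearMap.congr_fun hgf a
  have hle : LinearMap.range p ≤ LinearMap.range f := by
    refine Submodule.le_of_le_smul_of_le_jacobson_bot (I := IsLocalRing.maximalIdeal R)
      ?_ (IsLocalRing.maximalIdeal_le_jacobson _) ?_
    · rw [LinearMap.range_eq_map]
      exact Module.Finite.fg_top.map p
    · rintro _ ⟨x, rfl⟩
      obtain ⟨z, hz⟩ := hZ (1 ⊗ₜ p x) (by simp [hp])
      obtain ⟨a, rfl⟩ := hone z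
      rw [LinearMap.lTensor_tmul] at hz
      have h0 := hm (p x - f a) (by rw [TensorProduct.tmul_sub, hz, sub_self])
      have h1 := Submodule.mem_map_of_mem (f := p) h0
      rw [Submodule.map_smul'', ← LinearMap.range_eq_map, hp' _ (by simp [hp, hgf'])] at h1
      have : p x = f a + (p x - f a) := by abel
      rw [this]
      exact Submodule.add_mem_sup ⟨a, rfl⟩ h1
  refine ⟨fun x hx => hle ⟨x, hp' x hx⟩, ?_⟩
  obtain ⟨s, hs⟩ := Module.projective_lifting_property f.rangeRestrict
    (p.codRestrict (LinearMap.range f) fun x => hle ⟨x, rfl⟩) f.surjective_rangeRestrict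
  have hs' : ∀ x, f (s x) = p x := fun x => congrArg Subtype.val (LinearMap.congr_fun hs x)
  refine ⟨LinearMap.id - s.comp f, fun x => ?_, fun x hx => ?_⟩
  · simp [hs', hp' _ (hgf' x)]
  · simp [hx]

theorem stmt16 {K R : Type*} [Field K] [CommRing R] [Algebra K R] [IsLocalRing R]
    -- the composite `K → R → R/m` is an isomorphism
    (hbij : Function.Bijective
      ((Ideal.Quotient.mk (IsLocalRing.maximalIdeal R)).comp (algebraMap K R)))
    -- the `R`-module structure on `K` induced by `R → R/m ≅ K`
    [Module R K]
    (hact₁ : ∀ c x : K, (algebraMap K R c) • x = c * x)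
    (hact₂ : ∀ r ∈ IsLocalRing.maximalIdeal R, ∀ x : K, r • x = 0)
    -- a bounded cochain complex of finitely generated free `R`-modules
    (X : ℤ → Type*) [∀ k, AddCommGroup (X k)] [∀ k, Module R (X k)]
    [∀ k, Module.Finite R (X k)] [∀ k, Module.Free R (X k)]
    (d : ∀ k : ℤ, X k →ₗ[R] X (k + 1))
    (hdd : ∀ k : ℤ, (d (k + 1)).comp (d k) = 0)
    (hbdd : ∃ N : ℤ, ∀ k : ℤ, N ≤ |k| → Subsingleton (X k))
    (α : ℤ)
    -- `H^j(K ⊗_R X•) = 0` for all `j ≥ α`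
    (hZ : ∀ k : ℤ, α ≤ k + 1 →
      ∀ y : K ⊗[R] X (k + 1),
        LinearMap.lTensor K (d (k + 1)) y = 0 →
        ∃ z : K ⊗[R] X k, LinearMap.lTensor K (d k) z = y) :
    -- `H^j(X•) = 0` for all `j ≥ α`
    ∀ k : ℤ, α ≤ k + 1 → ∀ x : X (k + 1), d (k + 1) x = 0 → ∃ z : X k, d k z = x := by
  obtain ⟨N, hN⟩ := hbdd
  have key : ∀ k : ℤ, α ≤ k → ∃ q : X k →ₗ[R] X k,
      (∀ x, d k (q x) = 0) ∧ ∀ x, d k x = 0 → q x = x := by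
    have hbig : ∀ k : ℤ, N ≤ k → ∃ q : X k →ₗ[R] X k,
        (∀ x, d k (q x) = 0) ∧ ∀ x, d k x = 0 → q x = x := by
      intro k hk
      have := hN k (hk.trans (le_abs_self k))
      exact ⟨0, fun x => by simp, fun x _ => Subsingleton.elim _ _⟩
    have hind : ∀ n : ℕ, ∀ k : ℤ, α ≤ k → N ≤ k + n → ∃ q : X k →ₗ[R] X k,
        (∀ x, d k (q x) = 0) ∧ ∀ x, d k x = 0 → q x = x := by
      intro n
      induction n with
      | zero => intro k _ hk; exact hbig k (by simpa using hk)
      | succ n ih =>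
        intro k hα hk
        obtain ⟨p, hp, hp'⟩ := ih (k + 1) (by omega) (by push_cast at hk; omega)
        exact (aux_step_s16 hact₁ (d k) (d (k + 1)) (hdd k) (hZ k (by omega)) p hp hp').2
    intro k hk
    exact hind (N - k).toNat k hk (by omega)
  intro k hk
  obtain ⟨p, hp, hp'⟩ := key (k + 1) hk
  exact (aux_step_s16 hact₁ (d k) (d (k + 1)) (hdd k) (hZ k hk) p hp hp').1
end
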